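/- arXiv:2107.04199 — 6 statements merged into one kernel-verified Lean document; each statement's English description precedes it below -/
import Mathlib

section
/- (Hardy's theorem on ℝⁿ.) Let n ≥ 1, let 0 < a < b, and let f ∈ L¹(ℝⁿ). Suppose there are constants c₁, c₂ > 0 with |f(x)| ≤ c₁ e^{-|x|²/(4a)} for almost every x ∈ ℝⁿ and |f̂(ξ)| ≤ c₂ e^{-b|ξ|²} for every ξ ∈ ℝⁿ. Then f = 0 almost everywhere. -/
open MeasureTheory Real
open scoped RealInnerProductSpace ENNReal

/-- The Fourier transform on ℝⁿ with normalization
`f̂(ξ) = (2π)^{-n/2} ∫ f(y) e^{-i⟨y,ξ⟩} dy`. -/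
noncomputable def fourierTransform {n : ℕ} (f : EuclideanSpace ℝ (Fin n) → ℂ)
    (ξ : EuclideanSpace ℝ (Fin n)) : ℂ :=
  ((2 * Real.pi) ^ (-(n : ℝ) / 2) : ℝ) *
    ∫ y : EuclideanSpace ℝ (Fin n), f y * Complex.exp (-Complex.I * (⟪y, ξ⟫ : ℝ))

open Set Filter Topology in
/-- Phragmén-Lindelöf in a sector of opening less than `π / 2`, for order two growth. -/
theorem norm_mul_exp_le_of_sector {F : ℂ → ℂ} (hF : Differentiable ℂ F) {C a b : ℝ}
    (ha : 0 ≤ a) (hgrowth : ∀ z : ℂ, ‖F z‖ ≤ C * Real.exp (a * z.im ^ 2))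
    (hreal : ∀ x : ℝ, ‖F x‖ ≤ C * Real.exp (-b * x ^ 2))
    {φ K : ℝ} (hφ : φ ∈ Ioo 0 (π / 2))
    (hK : a * Real.sin φ ^ 2 + b * Real.cos (2 * φ) + K * Real.sin (2 * φ) ≤ 0)
    {ζ : ℂ} (h0 : 0 ≤ ζ.im) (h1 : ζ.im ≤ φ) :
    ‖F (Complex.exp ζ) * Complex.exp ((b - K * Complex.I) * Complex.exp (2 * ζ))‖ ≤ C := by
  have hC : 0 ≤ C := by
    have := (norm_nonneg _).trans (hgrowth 0)
    simpa using this
  have key : ∀ ζ : ℂ, ‖Complex.exp ((b - K * Complex.I) * Complex.exp (2 * ζ))‖ =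
      Real.exp (Real.exp ζ.re ^ 2 * (b * Real.cos (2 * ζ.im) + K * Real.sin (2 * ζ.im))) := by
    intro ζ
    rw [Complex.norm_exp, ← Real.exp_nat_mul]
    simp [Complex.exp_re, Complex.exp_im]
    ring
  have him : ∀ ζ : ℂ, a * (Complex.exp ζ).im ^ 2 = Real.exp ζ.re ^ 2 * (a * Real.sin ζ.im ^ 2) := by
    intro ζ
    rw [Complex.exp_im]; ring
  refine PhragmenLindelof.horizontal_strip (a := 0) (b := φ)
    (f := fun ζ => F (Complex.exp ζ) * Complex.exp ((b - K * Complex.I) * Complex.exp (2 * ζ)))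
    (Differentiable.diffContOnCl (by fun_prop)) ?_ ?_ ?_ h0 h1
  · refine ⟨2, ?_, a + |b| + |K|, ?_⟩
    · rw [sub_zero, lt_div_iff₀ hφ.1]; linarith [hφ.2]
    · refine Asymptotics.IsBigO.of_bound C (Eventually.of_forall fun ζ => ?_)
      rw [norm_mul, key, Real.norm_of_nonneg (Real.exp_nonneg _)]
      refine (mul_le_mul_of_nonneg_right (hgrowth _) (Real.exp_nonneg _)).trans ?_
      rw [mul_assoc, ← Real.exp_add, him, ← mul_add]
      refine mul_le_mul_of_nonneg_left (Real.exp_le_exp.2 ?_) hC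
      have e1 : Real.exp ζ.re ^ 2 ≤ Real.exp (2 * |ζ.re|) := by
        rw [← Real.exp_nat_mul]
        refine Real.exp_le_exp.2 ?_
        push_cast
        linarith [le_abs_self ζ.re]
      have e2 : a * Real.sin ζ.im ^ 2 + (b * Real.cos (2 * ζ.im) + K * Real.sin (2 * ζ.im))
          ≤ a + |b| + |K| := by
        have := mul_le_mul_of_nonneg_left (Real.sin_sq_le_one ζ.im) ha
        have h2 : b * Real.cos (2 * ζ.im) ≤ |b| := (le_abs_self _).trans (by
          rw [abs_mul]
          exact mul_le_of_le_one_right (abs_nonneg _) (Real.abs_cos_le_one _))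
        have h3 : K * Real.sin (2 * ζ.im) ≤ |K| := (le_abs_self _).trans (by
          rw [abs_mul]
          exact mul_le_of_le_one_right (abs_nonneg _) (Real.abs_sin_le_one _))
        linarith
      calc _ ≤ Real.exp ζ.re ^ 2 * (a + |b| + |K|) := by gcongr
        _ ≤ Real.exp (2 * |ζ.re|) * (a + |b| + |K|) := by gcongr
        _ = _ := mul_comm _ _
  · intro z hz
    have hz' : Complex.exp z = (Real.exp z.re : ℝ) := by
      apply Complex.ext <;> simp [Complex.exp_re, Complex.exp_im, hz, -Complex.ofReal_exp]
    rw [norm_mul, key, hz', hz]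
    refine (mul_le_mul_of_nonneg_right (hreal _) (Real.exp_nonneg _)).trans ?_
    rw [mul_assoc, ← Real.exp_add]
    simp [mul_comm]
  · intro z hz
    rw [norm_mul, key]
    refine (mul_le_mul_of_nonneg_right (hgrowth _) (Real.exp_nonneg _)).trans ?_
    rw [mul_assoc, ← Real.exp_add, him, ← mul_add, hz]
    refine mul_le_of_le_one_right hC (Real.exp_le_one_iff.2 ?_)
    exact mul_nonpos_of_nonneg_of_nonpos (by positivity) (by linarith)

open Set Filter Topology in
/-- **Hardy's theorem** for entire functions. -/
theorem entire_eq_zero_of_gaussian_bounds {F : ℂ → ℂ} (hF : Differentiable ℂ F) {C a b : ℝ}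
    (ha : 0 ≤ a) (hab : a < b) (hgrowth : ∀ z : ℂ, ‖F z‖ ≤ C * Real.exp (a * z.im ^ 2))
    (hreal : ∀ x : ℝ, ‖F x‖ ≤ C * Real.exp (-b * x ^ 2)) : F = 0 := by
  have hpi := Real.pi_pos
  have hzero : ∀ ζ : ℂ, 0 < ζ.im → ζ.im < π / 2 → F (Complex.exp ζ) = 0 := by
    intro ζ h0 h1
    have hs : 0 < Real.sin (2 * ζ.im) := Real.sin_pos_of_pos_of_lt_pi (by linarith) (by linarith)
    have hbound : ∀ K : ℝ, ‖F (Complex.exp ζ)‖ * Real.exp (Real.exp ζ.re ^ 2 *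
        (b * Real.cos (2 * ζ.im) + K * Real.sin (2 * ζ.im))) ≤ C := by
      intro K
      have hlim : ∀ᶠ φ in 𝓝[<] (π / 2),
          a * Real.sin φ ^ 2 + b * Real.cos (2 * φ) + K * Real.sin (2 * φ) < 0 := by
        refine nhdsWithin_le_nhds (ContinuousAt.eventually_lt (by fun_prop) continuousAt_const ?_)
        have : 2 * (π / 2) = π := by ring
        simp only [this, Real.sin_pi_div_two, Real.cos_pi, Real.sin_pi]
        linarith
      obtain ⟨φ, hφ, hφ'⟩ := (hlim.and (Ioo_mem_nhdsLT h1)).exists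
      have := norm_mul_exp_le_of_sector hF ha hgrowth hreal ⟨h0.trans hφ'.1, hφ'.2⟩ hφ.le h0.le
        hφ'.1.le
      rw [norm_mul, Complex.norm_exp] at this
      convert this using 3
      rw [← Real.exp_nat_mul]
      simp [Complex.exp_re, Complex.exp_im]
      ring
    by_contra hne
    have hpos := norm_pos_iff.2 hne
    have htend : Tendsto (fun K : ℝ => ‖F (Complex.exp ζ)‖ * Real.exp (Real.exp ζ.re ^ 2 *
        (b * Real.cos (2 * ζ.im) + K * Real.sin (2 * ζ.im)))) atTop atTop := by
      refine (Real.tendsto_exp_atTop.comp (Tendsto.const_mul_atTop (by positivity)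
        (tendsto_atTop_add_const_left _ _ (tendsto_id.atTop_mul_const hs)))).const_mul_atTop hpos
    obtain ⟨K, hK⟩ := (htend.eventually_gt_atTop C).exists
    exact (hbound K).not_gt hK
  have hev : F =ᶠ[𝓝 (1 + Complex.I)] 0 := by
    have h1 : ∀ᶠ z : ℂ in 𝓝 (1 + Complex.I), 0 < z.re :=
      continuousAt_const.eventually_lt Complex.continuous_re.continuousAt (by simp)
    have h2 : ∀ᶠ z : ℂ in 𝓝 (1 + Complex.I), 0 < z.im :=
      continuousAt_const.eventually_lt Complex.continuous_im.continuousAt (by simp)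
    filter_upwards [h1, h2] with z hr hi
    have hz : z ≠ 0 := fun h => by simp [h] at hr
    rw [← Complex.exp_log hz]
    refine hzero _ ?_ ?_
    · rw [Complex.log_im]
      refine lt_of_le_of_ne (Complex.arg_nonneg_iff.2 hi.le) fun h => ?_
      exact hi.ne (Complex.arg_eq_zero_iff.1 h.symm).2.symm
    · rw [Complex.log_im]
      exact (abs_lt.1 (Complex.abs_arg_lt_pi_div_two_iff.2 (Or.inl hr))).2
  have hA : AnalyticOnNhd ℂ F univ := fun z _ => hF.analyticAt z
  exact hA.eq_of_eventuallyEq analyticOnNhd_const hev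

theorem integrable_rexp_neg_mul_sq_norm_add {V : Type*} [NormedAddCommGroup V]
    [InnerProductSpace ℝ V] [FiniteDimensional ℝ V] [MeasurableSpace V] [BorelSpace V]
    {b : ℝ} (hb : 0 < b) (c : ℝ) (v : V) :
    Integrable (fun y : V => Real.exp (-b * ‖y‖ ^ 2 + c * ⟪v, y⟫)) := by
  have h := (GaussianFourier.integrable_cexp_neg_mul_sq_norm_add (b := b) (by simpa) (c : ℂ) v).norm
  convert h using 2 with y
  rw [Complex.norm_exp]
  norm_cast

theorem integral_rexp_neg_mul_sq_norm_add {V : Type*} [NormedAddCommGroup V]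
    [InnerProductSpace ℝ V] [FiniteDimensional ℝ V] [MeasurableSpace V] [BorelSpace V]
    {b : ℝ} (hb : 0 < b) (c : ℝ) (v : V) :
    ∫ y : V, Real.exp (-b * ‖y‖ ^ 2 + c * ⟪v, y⟫) =
      (π / b) ^ (Module.finrank ℝ V / 2 : ℝ) * Real.exp (c ^ 2 * ‖v‖ ^ 2 / (4 * b)) := by
  have h := GaussianFourier.integral_cexp_neg_mul_sq_norm_add (b := b) (by simpa) (c : ℂ) v
  apply Complex.ofReal_injective
  rw [← integral_complex_ofReal]
  push_cast [Complex.ofReal_cpow (div_pos Real.pi_pos hb).le]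
  exact h

/-- The Fourier transform is injective on integrable functions. -/
theorem ae_eq_zero_of_fourier_eq_zero {V : Type*} [NormedAddCommGroup V]
    [InnerProductSpace ℝ V] [FiniteDimensional ℝ V] [MeasurableSpace V] [BorelSpace V]
    {f : V → ℂ} (hf : Integrable f)
    (h : ∀ w, FourierTransform.fourier f w = 0) : f =ᵐ[volume] 0 := by
  refine ae_eq_zero_of_integral_contDiff_smul_eq_zero hf.locallyIntegrable fun g hg hgc => ?_
  have hg₁ : HasCompactSupport (Complex.ofRealCLM ∘ g) := hgc.comp_left rfl
  have hg₂ : ContDiff ℝ (⊤ : ℕ∞) (Complex.ofRealCLM ∘ g) := by fun_prop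
  let G : SchwartzMap V ℂ := hg₁.toSchwartzMap hg₂
  let H : SchwartzMap V ℂ := FourierTransformInv.fourierInv G
  have hH : FourierTransform.fourier (H : V → ℂ) = G := by
    rw [← SchwartzMap.fourier_coe]
    simp [H]
  have := VectorFourier.integral_fourierIntegral_smul_eq_flip (L := innerₗ V) (μ := volume)
    (ν := volume) (e := Real.fourierChar) Real.continuous_fourierChar
    (f := H) (g := f) continuous_inner H.integrable hf
  have h2 : ∫ x, G x • f x = 0 := by
    rw [← hH]
    refine Eq.trans this ?_
    have h0 : ∀ w, VectorFourier.fourierIntegral Real.fourierChar volume (innerₗ V) f w = 0 := h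
    simp [h0]
  simpa [G] using h2

theorem norm_mul_cexp_inner_le {V : Type*} [NormedAddCommGroup V] [InnerProductSpace ℝ V]
    {f : V → ℂ} {c a : ℝ} {y : V} (hy : ‖f y‖ ≤ c * Real.exp (-‖y‖ ^ 2 / (4 * a)))
    (v : V) (z : ℂ) :
    ‖f y * Complex.exp (-Complex.I * z * (⟪y, v⟫ : ℝ))‖ ≤
      c * Real.exp (-(1 / (4 * a)) * ‖y‖ ^ 2 + z.im * ⟪v, y⟫) := by
  rw [norm_mul, Complex.norm_exp]
  refine (mul_le_mul_of_nonneg_right hy (Real.exp_nonneg _)).trans_eq ?_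
  rw [mul_assoc, ← Real.exp_add, real_inner_comm]
  congr 2
  simp
  ring

theorem norm_integral_mul_cexp_inner_le {V : Type*} [NormedAddCommGroup V]
    [InnerProductSpace ℝ V] [FiniteDimensional ℝ V] [MeasurableSpace V] [BorelSpace V]
    {f : V → ℂ} {c a : ℝ} (ha : 0 < a)
    (hf : ∀ᵐ y, ‖f y‖ ≤ c * Real.exp (-‖y‖ ^ 2 / (4 * a))) (v : V) (z : ℂ) :
    ‖∫ y, f y * Complex.exp (-Complex.I * z * (⟪y, v⟫ : ℝ))‖ ≤
      c * (4 * π * a) ^ (Module.finrank ℝ V / 2 : ℝ) * Real.exp (a * ‖v‖ ^ 2 * z.im ^ 2) := by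
  have hb : 0 < 1 / (4 * a) := by positivity
  refine (norm_integral_le_of_norm_le
    ((integrable_rexp_neg_mul_sq_norm_add hb z.im v).const_mul c)
    (hf.mono fun y hy => norm_mul_cexp_inner_le hy v z)).trans_eq ?_
  rw [integral_const_mul, integral_rexp_neg_mul_sq_norm_add hb, mul_assoc]
  congr 3
  · field_simp
  · field_simp

/-- The Fourier transform of a function with Gaussian decay extends to an entire function along
every line. -/
theorem differentiable_integral_mul_cexp_inner {V : Type*} [NormedAddCommGroup V]
    [InnerProductSpace ℝ V] [FiniteDimensional ℝ V] [MeasurableSpace V] [BorelSpace V]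
    {f : V → ℂ} {c a : ℝ} (ha : 0 < a) (hm : AEStronglyMeasurable f volume)
    (hf : ∀ᵐ y, ‖f y‖ ≤ c * Real.exp (-‖y‖ ^ 2 / (4 * a))) (v : V) :
    Differentiable ℂ fun z : ℂ => ∫ y, f y * Complex.exp (-Complex.I * z * (⟪y, v⟫ : ℝ)) := by
  intro z₀
  have hb : 0 < 1 / (4 * a) := by positivity
  have hmeas : ∀ z : ℂ, AEStronglyMeasurable
      (fun y => f y * Complex.exp (-Complex.I * z * (⟪y, v⟫ : ℝ))) volume := fun z =>
    hm.mul (Continuous.aestronglyMeasurable (by fun_prop))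
  set R := ‖z₀‖ + 2
  refine (hasDerivAt_integral_of_dominated_loc_of_deriv_le (Metric.ball_mem_nhds z₀ one_pos)
    (F' := fun z y => f y * Complex.exp (-Complex.I * z * (⟪y, v⟫ : ℝ)) *
      (-Complex.I * (⟪y, v⟫ : ℝ)))
    (bound := fun y => c * Real.exp (-(1 / (4 * a)) * ‖y‖ ^ 2 + R * ⟪v, y⟫) +
      c * Real.exp (-(1 / (4 * a)) * ‖y‖ ^ 2 + (-R) * ⟪v, y⟫))
    (Filter.Eventually.of_forall hmeas) ?_ ?_ ?_ ?_ ?_).2.differentiableAt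
  · exact ((integrable_rexp_neg_mul_sq_norm_add hb z₀.im v).const_mul c).mono' (hmeas z₀)
      (hf.mono fun y hy => norm_mul_cexp_inner_le hy v z₀)
  · exact (hmeas z₀).mul (Continuous.aestronglyMeasurable (by fun_prop))
  · refine hf.mono fun y hy z hz => ?_
    have hc : 0 ≤ c := nonneg_of_mul_nonneg_left ((norm_nonneg _).trans hy) (Real.exp_pos _)
    have hzR : |z.im| + 1 ≤ R := by
      have h1 := Complex.abs_im_le_norm z
      have h2 := norm_le_norm_add_norm_sub' z z₀
      have h3 := mem_ball_iff_norm.1 hz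
      simp only [R]
      linarith
    rw [norm_mul]
    refine (mul_le_mul_of_nonneg_right (norm_mul_cexp_inner_le hy v z) (norm_nonneg _)).trans ?_
    rw [← mul_add, mul_assoc]
    refine mul_le_mul_of_nonneg_left ?_ hc
    simp only [Real.exp_add, ← mul_add, mul_assoc]
    refine mul_le_mul_of_nonneg_left ?_ (Real.exp_nonneg _)
    rw [real_inner_comm y v]
    set s := ⟪y, v⟫
    have hs : ‖-Complex.I * (s : ℂ)‖ ≤ Real.exp |s| := by
      simp only [norm_mul, norm_neg, Complex.norm_I, one_mul, Complex.norm_real, Real.norm_eq_abs]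
      linarith [Real.add_one_le_exp |s|]
    have hz : z.im * s + |s| ≤ R * |s| := by
      have : z.im * s ≤ |z.im| * |s| := (le_abs_self _).trans_eq (abs_mul _ _)
      nlinarith [abs_nonneg s]
    calc _ ≤ Real.exp (z.im * s) * Real.exp |s| := by gcongr
      _ ≤ Real.exp (R * |s|) := by rw [← Real.exp_add]; exact Real.exp_le_exp.2 hz
      _ ≤ _ := by
        rcases abs_choice s with h | h <;> rw [h]
        · linarith [Real.exp_pos (-R * s)]
        · rw [mul_neg, ← neg_mul]
          linarith [Real.exp_pos (R * s)]
  · exact ((integrable_rexp_neg_mul_sq_norm_add hb R v).const_mul c).add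
      ((integrable_rexp_neg_mul_sq_norm_add hb (-R) v).const_mul c)
  · refine Filter.Eventually.of_forall fun y z _ => ?_
    have := (((hasDerivAt_id z).const_mul (-Complex.I)).mul_const ((⟪y, v⟫ : ℝ) : ℂ)).cexp.const_mul
      (f y)
    simpa [mul_assoc] using this

/-- Hardy's theorem on ℝⁿ. -/
theorem hardy_theorem_Rn {n : ℕ} (hn : 1 ≤ n) (a b : ℝ) (ha : 0 < a) (hab : a < b)
    (f : EuclideanSpace ℝ (Fin n) → ℂ) (hf1 : Integrable f)
    (c₁ c₂ : ℝ) (hc₁ : 0 < c₁) (hc₂ : 0 < c₂)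
    (hf : ∀ᵐ x : EuclideanSpace ℝ (Fin n),
      ‖f x‖ ≤ c₁ * Real.exp (-‖x‖ ^ 2 / (4 * a)))
    (hfhat : ∀ ξ : EuclideanSpace ℝ (Fin n),
      ‖fourierTransform f ξ‖ ≤ c₂ * Real.exp (-b * ‖ξ‖ ^ 2)) :
    f =ᵐ[volume] 0 := by
  have h2π : (0 : ℝ) < 2 * π := by positivity
  have hne : ∀ v : EuclideanSpace ℝ (Fin n), v ≠ 0 → ∀ z : ℂ,
      ∫ y, f y * Complex.exp (-Complex.I * z * (⟪y, v⟫ : ℝ)) = 0 := by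
    intro v hv z
    have hv' : 0 < ‖v‖ ^ 2 := by positivity
    refine congrFun (entire_eq_zero_of_gaussian_bounds
      (C := max (c₁ * (4 * π * a) ^ (Module.finrank ℝ (EuclideanSpace ℝ (Fin n)) / 2 : ℝ))
        ((2 * π) ^ ((n : ℝ) / 2) * c₂))
      (a := a * ‖v‖ ^ 2) (b := b * ‖v‖ ^ 2)
      (differentiable_integral_mul_cexp_inner ha hf1.1 hf v) (by positivity) (by gcongr)
      (fun z => (norm_integral_mul_cexp_inner_le ha hf v z).trans ?_) fun x => ?_) z
    · gcongr
      exact le_max_left _ _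
    · have h := hfhat (x • v)
      rw [fourierTransform, norm_mul, Complex.norm_real, Real.norm_of_nonneg (by positivity),
        neg_div, Real.rpow_neg h2π.le, inv_mul_le_iff₀ (by positivity), ← mul_assoc] at h
      have he : Real.exp (-b * ‖x • v‖ ^ 2) = Real.exp (-(b * ‖v‖ ^ 2) * x ^ 2) := by
        rw [norm_smul, mul_pow, Real.norm_eq_abs, sq_abs]
        ring_nf
      rw [he] at h
      simp only [real_inner_smul_right, Complex.ofReal_mul, ← mul_assoc] at h
      refine h.trans ?_
      gcongr
      exact le_max_right _ _
  refine ae_eq_zero_of_fourier_eq_zero hf1 fun w => ?_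
  rw [Real.fourier_eq']
  obtain ⟨v, hv, z, hvz⟩ : ∃ v : EuclideanSpace ℝ (Fin n), v ≠ 0 ∧ ∃ z : ℝ, w = z • v := by
    by_cases hw : w = 0
    · have : Nonempty (Fin n) := ⟨⟨0, hn⟩⟩
      obtain ⟨v, hv⟩ := exists_ne (0 : EuclideanSpace ℝ (Fin n))
      exact ⟨v, hv, 0, by simp [hw]⟩
    · exact ⟨w, hw, 1, by simp⟩
  rw [← hne v hv (2 * π * z)]
  refine integral_congr_ae (Filter.Eventually.of_forall fun y => ?_)
  simp only [hvz, real_inner_smul_right, smul_eq_mul]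
  rw [mul_comm]
  congr 2
  push_cast
  ring
end

section
/- Let n ≥ 1 and k ∈ ℕ. For every z = x+iy ∈ ℂⁿ (x, y ∈ ℝⁿ) one has Σ_{|α|=k} |Φ_α(x+iy)|² ≤ π^{−n/2} L_k^{n−1}(−2|y|²) e^{|y|²}, where Φ_α denotes the entire extension to ℂⁿ of the n-dimensional Hermite function Φ_α. -/
open MeasureTheory Real

/-- The physicists' Hermite polynomial `H_m(t) = (−1)^m e^{t²} (d/dt)^m e^{−t²}`. -/
noncomputable def hermitePoly (m : ℕ) (t : ℝ) : ℝ :=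
  (-1 : ℝ) ^ m * Real.exp (t ^ 2) * iteratedDeriv m (fun s : ℝ => Real.exp (-s ^ 2)) t

/-- The L²-normalized Hermite function `h_m(t) = (2^m m! √π)^{−1/2} H_m(t) e^{−t²/2}`. -/
noncomputable def hermiteFn (m : ℕ) (t : ℝ) : ℝ :=
  (Real.sqrt ((2 : ℝ) ^ m * (Nat.factorial m : ℝ) * Real.sqrt Real.pi))⁻¹ *
    hermitePoly m t * Real.exp (-t ^ 2 / 2)

/-- The n-dimensional Hermite function `Φ_α(x) = Π_j h_{α_j}(x_j)`. -/
noncomputable def hermiteFnPi {n : ℕ} (α : Fin n → ℕ) (x : EuclideanSpace ℝ (Fin n)) : ℝ :=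
  ∏ j, hermiteFn (α j) (x j)

/-- The finite set of multi-indices `α ∈ ℕⁿ` with `|α| = k`. -/
noncomputable def multiIndices (n k : ℕ) : Finset (Fin n → ℕ) :=
  (Fintype.piFinset fun _ : Fin n => Finset.range (k + 1)).filter fun α => ∑ j, α j = k

/-- The Hermite coefficient `⟨f, Φ_α⟩`. -/
noncomputable def hermiteCoeff {n : ℕ} (f : EuclideanSpace ℝ (Fin n) → ℂ)
    (α : Fin n → ℕ) : ℂ :=
  ∫ x : EuclideanSpace ℝ (Fin n), f x * (hermiteFnPi α x : ℂ)

/-- The Hermite projection `P_k f = Σ_{|α|=k} ⟨f, Φ_α⟩ Φ_α`. -/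
noncomputable def hermiteProj {n : ℕ} (k : ℕ) (f : EuclideanSpace ℝ (Fin n) → ℂ)
    (x : EuclideanSpace ℝ (Fin n)) : ℂ :=
  ∑ α ∈ multiIndices n k, hermiteCoeff f α * (hermiteFnPi α x : ℂ)

/-- The Laguerre polynomial `L_k^a(t) = Σ_{j=0}^k (−1)^j (binom(k+a,k−j)/j!) t^j`. -/
noncomputable def laguerre (a k : ℕ) (t : ℝ) : ℝ :=
  ∑ j ∈ Finset.range (k + 1),
    (-1 : ℝ) ^ j * (Nat.choose (k + a) (k - j) : ℝ) / (Nat.factorial j : ℝ) * t ^ j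

/-- The entire extension of the physicists' Hermite polynomial,
`H_m(w) = (−1)^m e^{w²} (d/dw)^m e^{−w²}`. -/
noncomputable def hermitePolyC (m : ℕ) (w : ℂ) : ℂ :=
  (-1 : ℂ) ^ m * Complex.exp (w ^ 2) * iteratedDeriv m (fun s : ℂ => Complex.exp (-s ^ 2)) w

/-- The entire extension of the normalized Hermite function
`h_m(w) = (2^m m! √π)^{−1/2} H_m(w) e^{−w²/2}`. -/
noncomputable def hermiteFnC (m : ℕ) (w : ℂ) : ℂ :=
  ((Real.sqrt ((2 : ℝ) ^ m * (Nat.factorial m : ℝ) * Real.sqrt Real.pi) : ℝ) : ℂ)⁻¹ *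
    hermitePolyC m w * Complex.exp (-w ^ 2 / 2)

/-- The entire extension of the n-dimensional Hermite function,
`Φ_α(z) = Π_j h_{α_j}(z_j)`. -/
noncomputable def hermiteFnPiC {n : ℕ} (α : Fin n → ℕ) (z : Fin n → ℂ) : ℂ :=
  ∏ j, hermiteFnC (α j) (z j)


/-- At a positive global maximum `x₀ ≥ 0` of a decaying solution of the Hermite equation, the
potential gap `lam - x₀ ^ 2` is at least the real root `κ` of `κ + 4 / 9 * κ ^ 3 = lam`. -/
theorem gap_of_isMax {u v : ℝ → ℝ} {lam κ x₀ : ℝ}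
    (hu : ∀ x, HasDerivAt u (v x) x) (hv : ∀ x, HasDerivAt v ((x ^ 2 - lam) * u x) x)
    (hlim : Filter.Tendsto (fun x => (lam - x ^ 2) * u x ^ 2 + v x ^ 2) Filter.atTop (nhds 0))
    (hx₀ : 0 ≤ x₀) (hv₀ : v x₀ = 0) (hM : 0 < u x₀) (hmax : ∀ x, u x ≤ u x₀)
    (hκ : 0 < κ) (hlam : lam = κ + 4 / 9 * κ ^ 3) : κ ≤ lam - x₀ ^ 2 := by
  by_contra! hK
  set M := u x₀ with hMdef
  have hF : ∀ x, HasDerivAt (fun x => (lam - x ^ 2) * u x ^ 2 + v x ^ 2)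
      (-2 * x * u x ^ 2) x := by
    intro x
    have h := (((hasDerivAt_id x).pow 2).const_sub lam).mul ((hu x).pow 2) |>.add ((hv x).pow 2)
    refine h.congr_deriv ?_
    simp
    ring
  have hFanti : AntitoneOn (fun x => (lam - x ^ 2) * u x ^ 2 + v x ^ 2) (Set.Ici 0) := by
    refine antitoneOn_of_deriv_nonpos (convex_Ici 0)
      (fun x _ => (hF x).continuousAt.continuousWithinAt)
      (fun x _ => (hF x).differentiableAt.differentiableWithinAt) fun x hx => ?_
    rw [interior_Ici, Set.mem_Ioi] at hx
    rw [(hF x).deriv]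
    have := mul_nonneg hx.le (sq_nonneg (u x))
    linarith
  have hFnonneg : ∀ x, 0 ≤ x → 0 ≤ (lam - x ^ 2) * u x ^ 2 + v x ^ 2 := fun x hx =>
    le_of_tendsto hlim ((Filter.eventually_ge_atTop x).mono fun y hy =>
      hFanti (Set.mem_Ici.2 hx) (Set.mem_Ici.2 (hx.trans hy)) hy)
  have hus : ∀ s, HasDerivAt (fun s => u (x₀ + s)) (v (x₀ + s)) s := fun s =>
    (hu (x₀ + s)).comp_const_add x₀ s
  have hvs : ∀ s, HasDerivAt (fun s => v (x₀ + s)) (((x₀ + s) ^ 2 - lam) * u (x₀ + s)) s :=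
    fun s => (hv (x₀ + s)).comp_const_add x₀ s
  have hlow : ∀ t, 0 ≤ t → (∀ s, 0 ≤ s → s < t → 0 ≤ u (x₀ + s)) →
      M * (1 - κ * t ^ 2 / 2) ≤ u (x₀ + t) := by
    intro t ht hpos
    have hd1 : ∀ s, HasDerivAt (fun s => v (x₀ + s) + κ * M * s)
        (((x₀ + s) ^ 2 - lam) * u (x₀ + s) + κ * M) s := fun s => by
      refine ((hvs s).add ((hasDerivAt_id s).const_mul (κ * M))).congr_deriv ?_
      simp
    have hm1 : MonotoneOn (fun s => v (x₀ + s) + κ * M * s) (Set.Icc 0 t) := by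
      refine monotoneOn_of_deriv_nonneg (convex_Icc 0 t)
        (fun x _ => (hd1 x).continuousAt.continuousWithinAt)
        (fun x _ => (hd1 x).differentiableAt.differentiableWithinAt) fun x hx => ?_
      rw [interior_Icc] at hx
      rw [(hd1 x).deriv]
      have h1 := hpos x hx.1.le hx.2
      have h2 : -κ ≤ (x₀ + x) ^ 2 - lam := by nlinarith [mul_nonneg hx₀ hx.1.le, sq_nonneg x]
      have h3 := hmax (x₀ + x)
      nlinarith [mul_le_mul_of_nonneg_right h2 h1]
    have hd2 : ∀ s, HasDerivAt (fun s => u (x₀ + s) + κ * M * s ^ 2 / 2)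
        (v (x₀ + s) + κ * M * s) s := fun s => by
      refine ((hus s).add ((((hasDerivAt_id s).pow 2).const_mul (κ * M)).div_const 2)).congr_deriv ?_
      simp
      ring
    have hm2 : MonotoneOn (fun s => u (x₀ + s) + κ * M * s ^ 2 / 2) (Set.Icc 0 t) := by
      refine monotoneOn_of_deriv_nonneg (convex_Icc 0 t)
        (fun x _ => (hd2 x).continuousAt.continuousWithinAt)
        (fun x _ => (hd2 x).differentiableAt.differentiableWithinAt) fun x hx => ?_
      rw [interior_Icc] at hx
      rw [(hd2 x).deriv]
      have := hm1 (Set.left_mem_Icc.2 ht) ⟨hx.1.le, hx.2.le⟩ hx.1.le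
      simpa [hv₀] using this
    have := hm2 (Set.left_mem_Icc.2 ht) (Set.right_mem_Icc.2 ht) ht
    simp only [add_zero] at this
    rw [← hMdef] at this
    linarith
  set T := √(2 / κ) with hT
  have hT0 : 0 < T := by positivity
  have hT2 : κ * T ^ 2 = 2 := by
    rw [hT, Real.sq_sqrt (by positivity)]
    field_simp
  have hfac : ∀ t, 0 ≤ t → t < T → 0 < 1 - κ * t ^ 2 / 2 := by
    intro t ht htT
    have : t ^ 2 < T ^ 2 := by gcongr
    nlinarith
  have hupos : ∀ t, 0 ≤ t → t < T → 0 < u (x₀ + t) := by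
    by_contra! hcon
    obtain ⟨t, ht, htT, hut⟩ := hcon
    have hcont : Continuous fun s => u (x₀ + s) :=
      continuous_iff_continuousAt.2 fun s => (hus s).continuousAt
    have hcpt : IsCompact (Set.Icc 0 t ∩ (fun s => u (x₀ + s)) ⁻¹' Set.Iic 0) :=
      isCompact_Icc.inter_right (isClosed_Iic.preimage hcont)
    obtain ⟨s, ⟨⟨hs0, hst⟩, hs⟩, hleast⟩ := hcpt.exists_isLeast ⟨t, ⟨ht, le_rfl⟩, hut⟩
    have h := hlow s hs0 fun r hr hrs => by
      by_contra! hneg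
      exact absurd (hleast ⟨⟨hr, hrs.le.trans hst⟩, hneg.le⟩) (not_le.2 hrs)
    have h' := mul_pos hM (hfac s hs0 (hst.trans_lt htT))
    simp only [Set.mem_preimage, Set.mem_Iic] at hs
    linarith
  have hd3 : ∀ t, HasDerivAt (fun t => ((lam - (x₀ + t) ^ 2) * u (x₀ + t) ^ 2 + v (x₀ + t) ^ 2) +
      2 * x₀ * M ^ 2 * (t - κ * t ^ 3 / 3 + κ ^ 2 * t ^ 5 / 20))
      (-2 * (x₀ + t) * u (x₀ + t) ^ 2 + 2 * x₀ * M ^ 2 * (1 - κ * t ^ 2 / 2) ^ 2) t := by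
    intro t
    have h1 := (hF (x₀ + t)).comp_const_add x₀ t
    have h2 := (((hasDerivAt_id t).sub ((((hasDerivAt_id t).pow 3).const_mul κ).div_const 3)).add
      ((((hasDerivAt_id t).pow 5).const_mul (κ ^ 2)).div_const 20)).const_mul (2 * x₀ * M ^ 2)
    refine (h1.add h2).congr_deriv ?_
    simp only [id_eq]
    push_cast
    ring
  have hm3 : AntitoneOn (fun t => ((lam - (x₀ + t) ^ 2) * u (x₀ + t) ^ 2 + v (x₀ + t) ^ 2) +
      2 * x₀ * M ^ 2 * (t - κ * t ^ 3 / 3 + κ ^ 2 * t ^ 5 / 20)) (Set.Icc 0 T) := by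
    refine antitoneOn_of_deriv_nonpos (convex_Icc 0 T)
      (fun x _ => (hd3 x).continuousAt.continuousWithinAt)
      (fun x _ => (hd3 x).differentiableAt.differentiableWithinAt) fun t ht => ?_
    rw [interior_Icc] at ht
    rw [(hd3 t).deriv]
    have h1 := hlow t ht.1.le fun s hs hst => (hupos s hs (hst.trans ht.2)).le
    have h2 := mul_pos hM (hfac t ht.1.le ht.2)
    have h3 : (M * (1 - κ * t ^ 2 / 2)) ^ 2 ≤ u (x₀ + t) ^ 2 := by gcongr
    have h4 := mul_le_mul_of_nonneg_left h3 hx₀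
    have h5 := mul_nonneg ht.1.le (sq_nonneg (u (x₀ + t)))
    nlinarith
  have hfin := hm3 (Set.left_mem_Icc.2 hT0.le) (Set.right_mem_Icc.2 hT0.le) hT0.le
  have hend := hFnonneg (x₀ + T) (by positivity)
  have hTT : T - κ * T ^ 3 / 3 + κ ^ 2 * T ^ 5 / 20 = 8 / 15 * T := by
    linear_combination (-T / 3 + T * (κ * T ^ 2 + 2) / 20) * hT2
  simp only [add_zero, hv₀, hTT] at hfin
  rw [← hMdef] at hfin
  have hKT : 16 / 15 * (x₀ * T) ≤ lam - x₀ ^ 2 := by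
    have : M ^ 2 * (16 / 15 * (x₀ * T)) ≤ M ^ 2 * (lam - x₀ ^ 2) := by nlinarith
    exact le_of_mul_le_mul_left this (by positivity)
  have hx2 : 4 / 9 * κ ^ 3 < x₀ ^ 2 := by linarith
  have hsq : (16 / 15 * (x₀ * T)) ^ 2 < κ ^ 2 := by
    have := hKT.trans_lt hK
    gcongr
  have h6 : κ * (16 / 15 * (x₀ * T)) ^ 2 = 512 / 225 * x₀ ^ 2 := by
    linear_combination 256 / 225 * x₀ ^ 2 * hT2
  have h7 := mul_lt_mul_of_pos_left hsq hκ
  rw [h6] at h7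
  nlinarith [pow_pos hκ 3]

/-- The numerical inequality between the values of the modified energy at the origin and at a
critical point. -/
theorem energy_coeff_bound {κ K : ℝ} (hκ : 3 / 2 ≤ κ) (hK : κ ≤ K) {lam A q : ℝ}
    (hlam : lam = κ + 4 / 9 * κ ^ 3) (hA : A = lam + κ) (hq : q = κ + K) :
    16 / (3 * π) * lam * q ^ 5 ≤ (K * q ^ 2 + q / 2 + 3 / 2 * (A - q)) ^ 2 * A := by
  have hlam0 : 0 ≤ lam := by rw [hlam]; positivity
  have hq0 : 0 ≤ q := by linarith
  have h1 : 16 / (3 * π) ≤ 16 / (3 * 3.14) := by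
    have := Real.pi_gt_d2
    gcongr
  have h2 : 16 / (3 * π) * lam * q ^ 5 ≤ 16 / (3 * 3.14) * lam * q ^ 5 := by gcongr
  refine h2.trans ?_
  obtain ⟨s, hs, rfl⟩ : ∃ s, 0 ≤ s ∧ κ = 3 / 2 + s := ⟨κ - 3 / 2, by linarith, by ring⟩
  obtain ⟨t, ht, rfl⟩ : ∃ t, 0 ≤ t ∧ K = 3 / 2 + s + t := ⟨K - (3 / 2 + s), by linarith, by ring⟩
  subst hA hq hlam
  rw [← sub_nonneg]
  ring_nf
  positivity

theorem sq_le_of_energy {u v : ℝ → ℝ} {lam κ x₀ J : ℝ}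
    (hu : ∀ x, HasDerivAt u (v x) x) (hv : ∀ x, HasDerivAt v ((x ^ 2 - lam) * u x) x)
    (hx₀ : 0 ≤ x₀) (hv₀ : v x₀ = 0) (hJ : 0 ≤ J)
    (hκ : 3 / 2 ≤ κ) (hlam : lam = κ + 4 / 9 * κ ^ 3) (hK : κ ≤ lam - x₀ ^ 2)
    (h0 : (v 0 ^ 2 + (lam + 1 / (2 * lam)) * u 0 ^ 2) ^ 2 ≤ J ^ 2 * (16 / (3 * π) * lam)) :
    u x₀ ^ 2 ≤ J := by
  obtain ⟨A, hA⟩ : ∃ A, A = lam + κ := ⟨_, rfl⟩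
  have hlam0 : 0 < lam := by rw [hlam]; positivity
  have hA0 : 0 < A := by rw [hA]; linarith
  have hqpos : ∀ x ∈ Set.Icc 0 x₀, 2 * κ ≤ A - x ^ 2 := fun x hx => by
    have : x ^ 2 ≤ x₀ ^ 2 := by gcongr; exacts [hx.1, hx.2]
    linarith
  obtain ⟨g, hg⟩ : ∃ g : ℝ → ℝ, g = fun x => (√(A - x ^ 2))⁻¹ := ⟨_, rfl⟩
  have hgq : ∀ x ∈ Set.Icc 0 x₀, g x ^ 2 * (A - x ^ 2) = 1 := fun x hx => by
    have := hqpos x hx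
    have h : 0 < A - x ^ 2 := by linarith
    rw [hg]
    simp only [inv_pow, Real.sq_sqrt h.le]
    exact inv_mul_cancel₀ h.ne'
  have hg0 : ∀ x, 0 ≤ g x := fun x => by rw [hg]; positivity
  have hgd : ∀ x ∈ Set.Icc 0 x₀, HasDerivAt g (x * g x ^ 3) x := fun x hx => by
    have := hqpos x hx
    have h : 0 < A - x ^ 2 := by linarith
    have hs : √(A - x ^ 2) ≠ 0 := by positivity
    rw [hg]
    refine ((((hasDerivAt_id x).pow 2).const_sub A).sqrt (by simpa using h.ne')).inv
      (by simpa using hs) |>.congr_deriv ?_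
    simp
    field_simp
  obtain ⟨W, hW⟩ : ∃ W : ℝ → ℝ, W = fun x => g x * v x ^ 2 - x * g x ^ 3 * (u x * v x) +
      ((g x ^ 3 + 3 * x ^ 2 * g x ^ 5) / 2 + (lam - x ^ 2) * g x) * u x ^ 2 := ⟨_, rfl⟩
  have hWd : ∀ x ∈ Set.Icc 0 x₀, HasDerivAt W
      (-(x * g x ^ 7 * (2 * κ * (A - x ^ 2) ^ 2 + 3 * (A - x ^ 2) - 15 / 2 * A) * u x ^ 2)) x := by
    intro x hx
    have hg1 := hgd x hx
    have h1 := hg1.mul ((hv x).pow 2)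
    have h2 := ((hasDerivAt_id x).mul (hg1.pow 3)).mul ((hu x).mul (hv x))
    have h3 := (((hg1.pow 3).add ((((hasDerivAt_id x).pow 2).const_mul 3).mul (hg1.pow 5))).div_const
      2 |>.add ((((hasDerivAt_id x).pow 2).const_sub lam).mul hg1)).mul ((hu x).pow 2)
    rw [hW]
    refine ((h1.sub h2).add h3).congr_deriv ?_
    simp only [id_eq, Pi.pow_apply, Pi.mul_apply, Pi.add_apply]
    push_cast
    have e := hgq x hx
    generalize g x = G at *
    have hl : lam = A - κ := by linarith
    rw [hl]
    linear_combination (u x ^ 2 * (-9 / 2 * x * G ^ 5 + 2 * x * G +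
      2 * κ * x * G ^ 3 * (G ^ 2 * (A - x ^ 2) + 1))) * e
  have hWanti : AntitoneOn W (Set.Icc 0 x₀) := by
    refine antitoneOn_of_deriv_nonpos (convex_Icc 0 x₀)
      (fun x hx => (hWd x hx).continuousAt.continuousWithinAt)
      (fun x hx => (hWd x (interior_subset hx)).differentiableAt.differentiableWithinAt)
      fun x hx => ?_
    have hx' := interior_subset hx
    rw [(hWd x hx').deriv]
    have hq := hqpos x hx'
    have h1 : 0 ≤ 2 * κ * (A - x ^ 2) ^ 2 + 3 * (A - x ^ 2) - 15 / 2 * A := by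
      have h2 : (2 * κ) ^ 2 ≤ (A - x ^ 2) ^ 2 := by gcongr
      have h3 : (9 / 4 : ℝ) ≤ κ ^ 2 := by nlinarith
      rw [hA] at *
      nlinarith
    have := hg0 x
    have := hx'.1
    have : 0 ≤ x * g x ^ 7 * (2 * κ * (A - x ^ 2) ^ 2 + 3 * (A - x ^ 2) - 15 / 2 * A) * u x ^ 2 := by
      positivity
    linarith
  have hfin := hWanti (Set.left_mem_Icc.2 hx₀) (Set.right_mem_Icc.2 hx₀) hx₀
  obtain ⟨K, hKdef⟩ : ∃ K, K = lam - x₀ ^ 2 := ⟨_, rfl⟩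
  obtain ⟨q, hq⟩ : ∃ q, q = κ + K := ⟨_, rfl⟩
  rw [← hKdef] at hK
  have hcoef := energy_coeff_bound hκ hK hlam hA hq
  have hq0 : 0 < q := by linarith
  have e := hgq x₀ (Set.right_mem_Icc.2 hx₀)
  have e0 := hgq 0 (Set.left_mem_Icc.2 hx₀)
  have hqx : A - x₀ ^ 2 = q := by linarith
  have hB : 0 < K * q ^ 2 + q / 2 + 3 / 2 * (A - q) := by
    have : 0 ≤ A - q := by linarith [sq_nonneg x₀]
    have : 0 < K := by linarith
    positivity
  obtain ⟨B, hBdef⟩ : ∃ B, B = K * q ^ 2 + q / 2 + 3 / 2 * (A - q) := ⟨_, rfl⟩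
  rw [← hBdef] at hB hcoef
  rw [hqx] at e
  have hWx : W x₀ = g x₀ ^ 5 * B * u x₀ ^ 2 := by
    have hx2 : x₀ ^ 2 = A - q := by linarith
    have hlK : lam = K + (A - q) := by linarith
    rw [hW, hBdef]
    simp only [hv₀, hx2, hlK]
    linear_combination (-u x₀ ^ 2 * (g x₀ ^ 3 / 2 + K * g x₀ * (g x₀ ^ 2 * q + 1))) * e
  have hW0 : W 0 ≤ g 0 * (v 0 ^ 2 + (lam + 1 / (2 * lam)) * u 0 ^ 2) := by
    have h1 : g 0 ^ 2 ≤ 1 / lam := by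
      have : g 0 ^ 2 = 1 / A := by
        rw [eq_div_iff hA0.ne']
        simpa using e0
      rw [this]
      gcongr
      linarith
    have h2 : W 0 = g 0 * (v 0 ^ 2 + (lam + g 0 ^ 2 / 2) * u 0 ^ 2) := by
      rw [hW]
      ring
    rw [h2]
    have h3 : g 0 ^ 2 / 2 ≤ 1 / (2 * lam) := by
      have : 1 / (2 * lam) = 1 / lam / 2 := by field_simp
      linarith
    have := hg0 0
    gcongr
  have hsq : (g x₀ ^ 5 * B * u x₀ ^ 2) ^ 2 ≤
      (g 0 * (v 0 ^ 2 + (lam + 1 / (2 * lam)) * u 0 ^ 2)) ^ 2 := by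
    have := hg0 x₀
    rw [← hWx]
    have h : 0 ≤ W x₀ := by rw [hWx]; positivity
    gcongr
    exact hfin.trans hW0
  have h1 : A * q ^ 5 * (g x₀ ^ 5 * B * u x₀ ^ 2) ^ 2 = B ^ 2 * A * (u x₀ ^ 2) ^ 2 := by
    have : g x₀ ^ 10 * q ^ 5 = 1 := by
      rw [show g x₀ ^ 10 * q ^ 5 = (g x₀ ^ 2 * q) ^ 5 by ring, e, one_pow]
    linear_combination A * B ^ 2 * (u x₀ ^ 2) ^ 2 * this
  have h2 : A * q ^ 5 * (g 0 * (v 0 ^ 2 + (lam + 1 / (2 * lam)) * u 0 ^ 2)) ^ 2 =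
      q ^ 5 * (v 0 ^ 2 + (lam + 1 / (2 * lam)) * u 0 ^ 2) ^ 2 := by
    have : g 0 ^ 2 * A = 1 := by simpa using e0
    linear_combination q ^ 5 * (v 0 ^ 2 + (lam + 1 / (2 * lam)) * u 0 ^ 2) ^ 2 * this
  have h3 := mul_le_mul_of_nonneg_left hsq (show 0 ≤ A * q ^ 5 by positivity)
  rw [h1, h2] at h3
  have h4 := mul_le_mul_of_nonneg_left h0 (show 0 ≤ q ^ 5 by positivity)
  have h5 := mul_le_mul_of_nonneg_left hcoef (sq_nonneg J)
  have h6 : B ^ 2 * A * (u x₀ ^ 2) ^ 2 ≤ B ^ 2 * A * J ^ 2 := by linarith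
  exact (le_abs_self _).trans (abs_le_of_sq_le_sq (le_of_mul_le_mul_left h6 (by positivity)) hJ)

/-- A solution of the Hermite equation whose square is even, decaying at infinity, is bounded by
its Cauchy data at the origin. -/
theorem sq_le_of_hermite_ode {u v : ℝ → ℝ} {lam J : ℝ}
    (hu : ∀ x, HasDerivAt u (v x) x) (hv : ∀ x, HasDerivAt v ((x ^ 2 - lam) * u x) x)
    (hlim : Filter.Tendsto (fun x => (lam - x ^ 2) * u x ^ 2 + v x ^ 2) Filter.atTop (nhds 0))
    (hulim : Filter.Tendsto (fun x => u x ^ 2) Filter.atTop (nhds 0))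
    (heven : ∀ x, u (-x) ^ 2 = u x ^ 2) (hJ : 0 ≤ J) (hlam : 3 ≤ lam)
    (h0 : (v 0 ^ 2 + (lam + 1 / (2 * lam)) * u 0 ^ 2) ^ 2 ≤ J ^ 2 * (16 / (3 * π) * lam))
    (x : ℝ) : u x ^ 2 ≤ J := by
  by_contra! hx
  have hux : 0 < u x ^ 2 := hJ.trans_lt hx
  have hucont : Continuous fun x => u x ^ 2 :=
    (continuous_iff_continuousAt.2 fun s => (hu s).continuousAt).pow 2
  have htop : ∀ᶠ y in Filter.atTop, u y ^ 2 ≤ u x ^ 2 :=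
    (hulim.eventually (gt_mem_nhds hux)).mono fun y hy => hy.le
  obtain ⟨x₁, hx₁⟩ := hucont.exists_forall_ge' x (by
    rw [cocompact_eq_atBot_atTop, Filter.eventually_sup]
    refine ⟨?_, htop⟩
    filter_upwards [Filter.tendsto_neg_atBot_atTop.eventually htop] with y hy
    rwa [heven] at hy)
  obtain ⟨x₀, hx₀, hmax⟩ : ∃ x₀, 0 ≤ x₀ ∧ ∀ y, u y ^ 2 ≤ u x₀ ^ 2 := by
    rcases le_total 0 x₁ with h | h
    · exact ⟨x₁, h, hx₁⟩
    · exact ⟨-x₁, by linarith, fun y => by rw [heven]; exact hx₁ y⟩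
  have hux₀ : u x₀ ≠ 0 := fun h => by
    have := hmax x
    rw [h] at this
    linarith [zero_pow (M₀ := ℝ) two_ne_zero]
  have hv₀ : v x₀ = 0 := by
    have hmax' : IsLocalMax (fun x => u x ^ 2) x₀ := Filter.Eventually.of_forall hmax
    have := hmax'.hasDerivAt_eq_zero ((hu x₀).pow 2)
    simpa [hux₀] using this
  obtain ⟨κ, hκ, hκlam⟩ : ∃ κ, 3 / 2 ≤ κ ∧ lam = κ + 4 / 9 * κ ^ 3 := by
    have hc : ContinuousOn (fun κ : ℝ => κ + 4 / 9 * κ ^ 3) (Set.Icc (3 / 2) lam) := by fun_prop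
    obtain ⟨κ, hκ, h⟩ := intermediate_value_Icc (by linarith) hc
      (show lam ∈ Set.Icc _ _ by
        constructor
        · norm_num
          linarith
        · have : 0 ≤ lam ^ 3 := by positivity
          linarith)
    exact ⟨κ, hκ.1, h.symm⟩
  have hgap : κ ≤ lam - x₀ ^ 2 := by
    rcases lt_or_gt_of_ne hux₀ with h | h
    · refine gap_of_isMax (u := fun x => -u x) (v := fun x => -v x) (fun y => (hu y).neg)
        (fun y => ((hv y).neg).congr_deriv (by ring)) (by simpa using hlim) hx₀ (by simpa using hv₀)
        (by simpa using h) (fun y => ?_) (by linarith) hκlam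
      have := abs_le_of_sq_le_sq' (a := u y) (b := -u x₀) (by simpa using hmax y) (by linarith)
      linarith [this.1]
    · refine gap_of_isMax hu hv hlim hx₀ hv₀ h (fun y => ?_) (by linarith) hκlam
      exact (abs_le_of_sq_le_sq' (hmax y) h.le).2
  have := sq_le_of_energy hu hv hx₀ hv₀ hJ hκ hκlam hgap h0
  linarith [hmax x]

/-- A sharp lower bound for the Wallis product. -/
theorem pi_div_two_le_wallis (j : ℕ) : π / 2 ≤ Wallis.W j * ((4 * j + 2) / (4 * j + 1)) := by
  have hanti : Antitone fun j : ℕ => Wallis.W j * ((4 * j + 2 : ℝ) / (4 * j + 1)) := by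
    refine antitone_nat_of_succ_le fun j => ?_
    rw [Wallis.W_succ, mul_assoc]
    refine mul_le_mul_of_nonneg_left ?_ (Wallis.W_pos j).le
    push_cast
    rw [div_mul_div_comm, div_mul_div_comm, div_le_div_iff₀ (by positivity) (by positivity)]
    rw [← sub_nonneg]
    ring_nf
    positivity
  have hlim : Filter.Tendsto (fun j : ℕ => Wallis.W j * ((4 * j + 2 : ℝ) / (4 * j + 1)))
      Filter.atTop (nhds (π / 2 * 1)) := by
    refine Wallis.tendsto_W_nhds_pi_div_two.mul ?_
    have h : ∀ n : ℕ, ((4 : ℝ) * n + 2) / (4 * n + 1) = 1 + 1 / (4 * n + 1) := by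
      intro n
      field_simp
      ring
    simp_rw [h]
    have : Filter.Tendsto (fun n : ℕ => 1 / (4 * n + 1 : ℝ)) Filter.atTop (nhds 0) := by
      refine tendsto_const_nhds.div_atTop ?_
      refine Filter.Tendsto.atTop_add ?_ tendsto_const_nhds
      exact tendsto_natCast_atTop_atTop.const_mul_atTop four_pos
    simpa using this.const_add 1
  simpa using hanti.le_of_tendsto hlim j

theorem centralBinom_ratio_sq_le (j : ℕ) :
    ((2 * j).factorial / (4 ^ j * (j.factorial : ℝ) ^ 2)) ^ 2 ≤ 4 / (π * (4 * j + 1)) := by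
  have h := pi_div_two_le_wallis j
  rw [Wallis.W_eq_factorial_ratio] at h
  have hf : (0 : ℝ) < (2 * j).factorial := by positivity
  have hg : (0 : ℝ) < j.factorial := by positivity
  have e : (2 : ℝ) ^ (4 * j) = 4 ^ j * 4 ^ j := by
    rw [← pow_add, ← two_mul, show (4 : ℝ) = 2 ^ 2 by norm_num, ← pow_mul]
    ring_nf
  rw [e] at h
  have hp : (0 : ℝ) < 4 ^ j := by positivity
  generalize ((2 * j).factorial : ℝ) = a at *
  generalize (j.factorial : ℝ) = b at *
  generalize (4 : ℝ) ^ j = p at *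
  rw [div_mul_div_comm, le_div_iff₀ (by positivity)] at h
  rw [div_pow, div_le_div_iff₀ (by positivity) (by positivity)]
  have hj : (0 : ℝ) < 2 * j + 1 := by positivity
  refine le_of_mul_le_mul_right ?_ hj
  nlinarith

/-- The physicists' Hermite polynomials. -/
noncomputable def physHermite : ℕ → Polynomial ℝ
  | 0 => 1
  | m + 1 => Polynomial.C 2 * Polynomial.X * physHermite m - Polynomial.derivative (physHermite m)

theorem physHermite_succ (m : ℕ) : physHermite (m + 1) =
    Polynomial.C 2 * Polynomial.X * physHermite m - Polynomial.derivative (physHermite m) := rfl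

theorem derivative_physHermite_succ (m : ℕ) : Polynomial.derivative (physHermite (m + 1)) =
    Polynomial.C (2 * (m + 1 : ℝ)) * physHermite m := by
  induction m with
  | zero => simp [physHermite]
  | succ m ih =>
    rw [physHermite_succ (m + 1), Polynomial.derivative_sub, Polynomial.derivative_mul,
      Polynomial.derivative_C_mul, Polynomial.derivative_X, ih, Polynomial.derivative_C_mul]
    rw [physHermite_succ m]
    simp only [map_mul, map_add, map_one, map_natCast, Nat.cast_add, Nat.cast_one, map_ofNat]
    ring

theorem physHermite_add_two (m : ℕ) : physHermite (m + 2) =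
    Polynomial.C 2 * Polynomial.X * physHermite (m + 1) -
      Polynomial.C (2 * (m + 1 : ℝ)) * physHermite m := by
  rw [physHermite_succ (m + 1), derivative_physHermite_succ]

theorem physHermite_ode (m : ℕ) :
    Polynomial.derivative (Polynomial.derivative (physHermite m)) =
      Polynomial.C 2 * Polynomial.X * Polynomial.derivative (physHermite m) -
        Polynomial.C (2 * m : ℝ) * physHermite m := by
  have h := derivative_physHermite_succ m
  rw [physHermite_succ m, Polynomial.derivative_sub, Polynomial.derivative_mul,
      Polynomial.derivative_C_mul, Polynomial.derivative_X] at h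
  simp only [map_mul, map_add, map_one, map_natCast, map_ofNat] at h ⊢
  linear_combination -h

theorem eval_neg_physHermite (m : ℕ) (x : ℝ) :
    (physHermite m).eval (-x) = (-1) ^ m * (physHermite m).eval x ∧
    (physHermite (m + 1)).eval (-x) = (-1) ^ (m + 1) * (physHermite (m + 1)).eval x := by
  induction m with
  | zero => simp [physHermite]
  | succ m ih =>
    refine ⟨ih.2, ?_⟩
    rw [physHermite_add_two]
    simp only [Polynomial.eval_sub, Polynomial.eval_mul, Polynomial.eval_C, Polynomial.eval_X,
      ih.1, ih.2]
    ring

theorem eval_zero_physHermite (j : ℕ) :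
    (physHermite (2 * j)).eval 0 = (-1) ^ j * (2 * j).factorial / j.factorial ∧
    (physHermite (2 * j + 1)).eval 0 = 0 := by
  induction j with
  | zero => simp [physHermite]
  | succ j ih =>
    have h : (physHermite (2 * (j + 1))).eval 0 =
        (-1) ^ (j + 1) * (2 * (j + 1)).factorial / (j + 1).factorial := by
      rw [show 2 * (j + 1) = 2 * j + 2 by ring, physHermite_add_two]
      simp only [Polynomial.eval_sub, Polynomial.eval_mul, Polynomial.eval_C, Polynomial.eval_X,
        ih.1, ih.2, Nat.factorial_succ]
      push_cast
      field_simp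
      ring
    refine ⟨h, ?_⟩
    rw [show 2 * (j + 1) + 1 = 2 * j + 1 + 2 by ring, physHermite_add_two]
    simp only [Polynomial.eval_sub, Polynomial.eval_mul, Polynomial.eval_C, Polynomial.eval_X,
        ih.2]
    ring

theorem eval_zero_physHermite_sq (j : ℕ) : (physHermite (2 * j)).eval 0 ^ 2 =
    2 ^ (2 * j) * (2 * j).factorial * ((2 * j).factorial / (4 ^ j * (j.factorial : ℝ) ^ 2)) := by
  rw [(eval_zero_physHermite j).1, pow_mul]
  norm_num
  field_simp
  rw [← pow_mul, mul_comm j 2, pow_mul]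
  norm_num

theorem tendsto_eval_mul_exp_neg_sq (p : Polynomial ℝ) :
    Filter.Tendsto (fun x => p.eval x * Real.exp (-x ^ 2)) Filter.atTop (nhds 0) := by
  have h := (Polynomial.tendsto_div_exp_atTop p).norm
  rw [norm_zero] at h
  refine squeeze_zero_norm' ?_ h
  filter_upwards [Filter.eventually_ge_atTop 1] with x hx
  rw [div_eq_mul_inv, ← Real.exp_neg, norm_mul, norm_mul, Real.norm_eq_abs (Real.exp _),
    Real.norm_eq_abs (Real.exp _), Real.abs_exp, Real.abs_exp]
  gcongr
  nlinarith

theorem physHermite_cauchy_data_le {m : ℕ} (hm : m ≠ 0) {lam : ℝ} (hlam : lam = 2 * m + 1) :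
    ((Polynomial.derivative (physHermite m)).eval 0 ^ 2 +
      (lam + 1 / (2 * lam)) * (physHermite m).eval 0 ^ 2) ^ 2 ≤
      ((2 : ℝ) ^ m * m.factorial) ^ 2 * (16 / (3 * π) * lam) := by
  obtain ⟨j, hj⟩ := Nat.even_or_odd' m
  have hc := centralBinom_ratio_sq_le j
  have hsq := eval_zero_physHermite_sq j
  have hpi := Real.pi_pos
  rcases hj with rfl | rfl
  · have hd : (Polynomial.derivative (physHermite (2 * j))).eval 0 = 0 := by
      obtain ⟨i, rfl⟩ := Nat.exists_eq_succ_of_ne_zero (show j ≠ 0 by omega)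
      rw [show 2 * (i + 1) = 2 * i + 1 + 1 by ring, derivative_physHermite_succ,
        Polynomial.eval_mul, (eval_zero_physHermite i).2, mul_zero]
    have hj1 : (1 : ℝ) ≤ j := by exact_mod_cast (show 1 ≤ j by omega)
    push_cast at hlam
    rw [hd, hsq]
    generalize ((2 * j).factorial / (4 ^ j * (j.factorial : ℝ) ^ 2) : ℝ) = c at *
    have h5 : 5 ≤ lam := by linarith
    rw [show 4 * (j : ℝ) + 1 = lam by linarith] at hc
    have h6 : (lam + 1 / (2 * lam)) ^ 2 ≤ 4 / 3 * lam ^ 2 := by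
      have : 1 / (2 * lam) ≤ 1 / 10 := by gcongr; linarith
      have : 0 ≤ 1 / (2 * lam) := by positivity
      nlinarith
    have h7 : (lam + 1 / (2 * lam)) ^ 2 * c ^ 2 ≤ 16 / (3 * π) * lam := by
      calc _ ≤ 4 / 3 * lam ^ 2 * (4 / (π * lam)) := by gcongr
        _ = _ := by field_simp; ring
    calc _ = (2 ^ (2 * j) * ((2 * j).factorial : ℝ)) ^ 2 *
          ((lam + 1 / (2 * lam)) ^ 2 * c ^ 2) := by ring
      _ ≤ _ := by gcongr
  · rw [derivative_physHermite_succ, (eval_zero_physHermite j).2, Polynomial.eval_mul,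
      Polynomial.eval_C, mul_pow, hsq]
    push_cast at hlam ⊢
    generalize ((2 * j).factorial / (4 ^ j * (j.factorial : ℝ) ^ 2) : ℝ) = c at *
    have h7 : (2 * (2 * j + 1)) ^ 2 * c ^ 2 ≤ 16 / (3 * π) * lam := by
      calc _ ≤ (2 * (2 * j + 1 : ℝ)) ^ 2 * (4 / (π * (4 * j + 1))) := by gcongr
        _ ≤ _ := by
          rw [mul_div_assoc', div_mul_eq_mul_div, div_le_div_iff₀ (by positivity) (by positivity),
            hlam, ← sub_nonneg]
          ring_nf
          positivity
    calc _ = (2 ^ (2 * j + 1) * ((2 * j + 1) * (2 * j).factorial : ℝ)) ^ 2 *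
          ((2 * (2 * j + 1)) ^ 2 * c ^ 2) := by ring
      _ ≤ (2 ^ (2 * j + 1) * ((2 * j + 1) * (2 * j).factorial : ℝ)) ^ 2 *
          (16 / (3 * π) * lam) := by gcongr
      _ = _ := by
        rw [Nat.factorial_succ]
        push_cast
        ring

/-- Cramér's inequality with the sharp constant. -/
theorem physHermite_sq_mul_exp_le (m : ℕ) (x : ℝ) :
    (physHermite m).eval x ^ 2 * Real.exp (-x ^ 2) ≤ 2 ^ m * m.factorial := by
  rcases eq_or_ne m 0 with rfl | hm
  · simpa [physHermite] using sq_nonneg x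
  obtain ⟨lam, hlam⟩ : ∃ lam : ℝ, lam = 2 * m + 1 := ⟨_, rfl⟩
  have hm1 : (1 : ℝ) ≤ m := by exact_mod_cast Nat.one_le_iff_ne_zero.2 hm
  have hexp : ∀ x : ℝ, Real.exp (-x ^ 2 / 2) ^ 2 = Real.exp (-x ^ 2) := fun x => by
    rw [← Real.exp_nat_mul]
    congr 1
    push_cast
    ring
  have hE : ∀ x : ℝ, HasDerivAt (fun x : ℝ => Real.exp (-x ^ 2 / 2))
      (-x * Real.exp (-x ^ 2 / 2)) x := fun x => by
    refine ((((hasDerivAt_id x).pow 2).neg.div_const 2).exp).congr_deriv ?_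
    simp
    ring
  set p := physHermite m with hp
  set d := Polynomial.derivative p with hd
  have h := sq_le_of_hermite_ode (u := fun x => p.eval x * Real.exp (-x ^ 2 / 2))
    (v := fun x => (d.eval x - x * p.eval x) * Real.exp (-x ^ 2 / 2)) (lam := lam)
    (J := 2 ^ m * m.factorial) (fun x => ?_) (fun x => ?_) ?_ ?_ (fun x => ?_) (by positivity)
    (by linarith) ?_ x
  · simpa only [mul_pow, hexp] using h
  · refine ((p.hasDerivAt x).mul (hE x)).congr_deriv ?_
    ring
  · refine (((d.hasDerivAt x).sub ((hasDerivAt_id x).mul (p.hasDerivAt x))).mul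
      (hE x)).congr_deriv ?_
    have := congrArg (Polynomial.eval x) (physHermite_ode m)
    rw [← hp, ← hd] at this
    simp only [Polynomial.eval_sub, Polynomial.eval_mul, Polynomial.eval_C,
      Polynomial.eval_X] at this
    simp only [id_eq, this, hlam, ← hd, Pi.sub_apply, Pi.mul_apply]
    ring
  · convert tendsto_eval_mul_exp_neg_sq ((Polynomial.C lam - Polynomial.X ^ 2) * p ^ 2 +
      (d - Polynomial.X * p) ^ 2) using 2 with x
    rw [mul_pow, mul_pow, hexp]
    simp only [Polynomial.eval_sub, Polynomial.eval_mul, Polynomial.eval_C, Polynomial.eval_pow,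
      Polynomial.eval_X, Polynomial.eval_add]
    ring
  · convert tendsto_eval_mul_exp_neg_sq (p ^ 2) using 2 with x
    rw [mul_pow, hexp, Polynomial.eval_pow]
  · rw [mul_pow, mul_pow, (eval_neg_physHermite m x).1, neg_sq, mul_pow, ← pow_mul, mul_comm m 2,
      pow_mul]
    simp [p]
  · simpa [← hp, ← hd] using physHermite_cauchy_data_le hm hlam

theorem laguerre_eq_sum_antidiagonal (a k : ℕ) (t : ℝ) : laguerre a k t =
    ∑ p ∈ Finset.HasAntidiagonal.antidiagonal k, ((a + p.1 + p.2).choose p.2 : ℝ) * ((-t) ^ p.1 / p.1.factorial) := by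
  rw [Finset.Nat.sum_antidiagonal_eq_sum_range_succ
    (f := fun i j => ((a + i + j).choose j : ℝ) * ((-t) ^ i / i.factorial)), laguerre]
  refine Finset.sum_congr rfl fun j hj => ?_
  have hjk : j ≤ k := Nat.lt_succ_iff.1 (Finset.mem_range.1 hj)
  rw [show a + j + (k - j) = k + a by omega, neg_pow t]
  ring

theorem sum_antidiagonal_choose_mul_choose (a b k : ℕ) :
    ∑ p ∈ Finset.HasAntidiagonal.antidiagonal k, ((a + p.1).choose p.1 : ℝ) * ((b + p.2).choose p.2 : ℝ) =
      (a + b + 1 + k).choose k := by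
  have h := congrArg (PowerSeries.coeff k)
    (congrArg Units.val (PowerSeries.invOneSubPow_add (S := ℝ) (a + 1) (b + 1)))
  rw [Units.val_mul, show a + 1 + (b + 1) = (a + b + 1) + 1 by ring,
    PowerSeries.invOneSubPow_val_succ_eq_mk_add_choose,
    PowerSeries.invOneSubPow_val_succ_eq_mk_add_choose,
    PowerSeries.invOneSubPow_val_succ_eq_mk_add_choose, PowerSeries.coeff_mul] at h
  simp only [PowerSeries.coeff_mk] at h
  rw [← Nat.choose_symm_add, h]
  exact Finset.sum_congr rfl fun p _ => by rw [Nat.choose_symm_add, Nat.choose_symm_add]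

theorem add_pow_div_factorial (s t : ℝ) (N : ℕ) : (s + t) ^ N / N.factorial =
    ∑ p ∈ Finset.HasAntidiagonal.antidiagonal N, s ^ p.1 / p.1.factorial * (t ^ p.2 / p.2.factorial) := by
  rw [Commute.add_pow' (Commute.all s t), Finset.sum_div]
  refine Finset.sum_congr rfl fun p hp => ?_
  rw [Finset.HasAntidiagonal.mem_antidiagonal] at hp
  subst hp
  have := Nat.add_choose_mul_factorial_mul_factorial p.1 p.2
  have h : (((p.1 + p.2).choose p.1 : ℝ)) * p.1.factorial * p.2.factorial =
      (p.1 + p.2).factorial := by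
    rw [Nat.choose_symm_add]
    exact_mod_cast this
  rw [nsmul_eq_mul, ← h]
  have : ((p.1 + p.2).choose p.1 : ℝ) ≠ 0 := by
    exact_mod_cast (Nat.choose_pos (Nat.le_add_right _ _)).ne'
  field_simp

theorem sum_antidiagonal_antidiagonal_comm (k : ℕ) (f : ℕ → ℕ → ℕ → ℕ → ℝ) :
    ∑ p ∈ Finset.HasAntidiagonal.antidiagonal k, ∑ q ∈ Finset.HasAntidiagonal.antidiagonal p.1, ∑ r ∈ Finset.HasAntidiagonal.antidiagonal p.2,
      f q.1 q.2 r.1 r.2 =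
    ∑ p ∈ Finset.HasAntidiagonal.antidiagonal k, ∑ q ∈ Finset.HasAntidiagonal.antidiagonal p.1, ∑ r ∈ Finset.HasAntidiagonal.antidiagonal p.2,
      f q.1 r.1 q.2 r.2 := by
  simp_rw [← Finset.sum_product', Finset.sum_sigma']
  refine Finset.sum_nbij' (fun x => ⟨(x.2.1.1 + x.2.2.1, x.2.1.2 + x.2.2.2),
      ((x.2.1.1, x.2.2.1), (x.2.1.2, x.2.2.2))⟩)
    (fun x => ⟨(x.2.1.1 + x.2.2.1, x.2.1.2 + x.2.2.2),
      ((x.2.1.1, x.2.2.1), (x.2.1.2, x.2.2.2))⟩) ?_ ?_ ?_ ?_ ?_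
  · rintro ⟨⟨a, b⟩, ⟨c, d⟩, ⟨e, f⟩⟩ h
    simp only [Finset.mem_sigma, Finset.mem_product, Finset.HasAntidiagonal.mem_antidiagonal] at h ⊢
    exact ⟨by omega, trivial, trivial⟩
  · rintro ⟨⟨a, b⟩, ⟨c, d⟩, ⟨e, f⟩⟩ h
    simp only [Finset.mem_sigma, Finset.mem_product, Finset.HasAntidiagonal.mem_antidiagonal] at h ⊢
    exact ⟨by omega, trivial, trivial⟩
  · rintro ⟨⟨a, b⟩, ⟨c, d⟩, ⟨e, f⟩⟩ h
    simp only [Finset.mem_sigma, Finset.mem_product, Finset.HasAntidiagonal.mem_antidiagonal] at h ⊢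
    obtain ⟨h1, h2, h3⟩ := h
    subst h2 h3
    rfl
  · rintro ⟨⟨a, b⟩, ⟨c, d⟩, ⟨e, f⟩⟩ h
    simp only [Finset.mem_sigma, Finset.mem_product, Finset.HasAntidiagonal.mem_antidiagonal] at h ⊢
    obtain ⟨h1, h2, h3⟩ := h
    subst h2 h3
    rfl
  · intros
    rfl

/-- The addition formula for Laguerre polynomials. -/
theorem sum_antidiagonal_laguerre_mul (a b k : ℕ) (s t : ℝ) :
    ∑ p ∈ Finset.HasAntidiagonal.antidiagonal k, laguerre a p.1 s * laguerre b p.2 t =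
      laguerre (a + b + 1) k (s + t) := by
  simp_rw [laguerre_eq_sum_antidiagonal, Finset.sum_mul_sum]
  rw [sum_antidiagonal_antidiagonal_comm k fun i j i' j' =>
    (((a + i + j).choose j : ℝ) * ((-s) ^ i / i.factorial)) *
      (((b + i' + j').choose j' : ℝ) * ((-t) ^ i' / i'.factorial))]
  refine Finset.sum_congr rfl fun p _ => ?_
  rw [neg_add, add_pow_div_factorial, Finset.mul_sum]
  refine Finset.sum_congr rfl fun q hq => ?_
  rw [Finset.HasAntidiagonal.mem_antidiagonal] at hq
  rw [← hq, show a + b + 1 + (q.1 + q.2) + p.2 = a + q.1 + (b + q.2) + 1 + p.2 by ring,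
    ← sum_antidiagonal_choose_mul_choose, Finset.sum_mul]
  refine Finset.sum_congr rfl fun r _ => ?_
  ring

theorem mem_multiIndices {n k : ℕ} {α : Fin n → ℕ} : α ∈ multiIndices n k ↔ ∑ j, α j = k := by
  simp only [multiIndices, Finset.mem_filter, Fintype.mem_piFinset, Finset.mem_range,
    and_iff_right_iff_imp]
  rintro rfl j
  exact Nat.lt_succ_of_le (Finset.single_le_sum (fun _ _ => Nat.zero_le _) (Finset.mem_univ j))

theorem sum_multiIndices_succ {n k : ℕ} (f : (Fin (n + 1) → ℕ) → ℝ) :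
    ∑ α ∈ multiIndices (n + 1) k, f α =
      ∑ p ∈ Finset.HasAntidiagonal.antidiagonal k, ∑ β ∈ multiIndices n p.2, f (Fin.cons p.1 β) := by
  rw [Finset.sum_sigma']
  refine Finset.sum_nbij' (fun α => ⟨(α 0, ∑ j, Fin.tail α j), Fin.tail α⟩)
    (fun x => Fin.cons x.1.1 x.2) ?_ ?_ ?_ ?_ ?_
  · intro α h
    rw [mem_multiIndices, Fin.sum_univ_succ] at h
    simpa [mem_multiIndices, Fin.tail] using h
  · rintro ⟨⟨i, j⟩, β⟩ h
    simp only [Finset.mem_sigma, Finset.HasAntidiagonal.mem_antidiagonal, mem_multiIndices] at h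
    simp [mem_multiIndices, Fin.sum_univ_succ, h.1, h.2]
  · intro α _
    exact Fin.cons_self_tail α
  · rintro ⟨⟨i, j⟩, β⟩ h
    simp only [Finset.mem_sigma, Finset.HasAntidiagonal.mem_antidiagonal, mem_multiIndices] at h
    obtain ⟨-, rfl⟩ := h
    rfl
  · intro α _
    rw [Fin.cons_self_tail]

theorem sum_multiIndices_prod_laguerre (n k : ℕ) (t : Fin (n + 1) → ℝ) :
    ∑ α ∈ multiIndices (n + 1) k, ∏ j, laguerre 0 (α j) (t j) = laguerre n k (∑ j, t j) := by
  induction n generalizing k with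
  | zero =>
    have : multiIndices 1 k = {fun _ => k} := by
      ext α
      rw [mem_multiIndices, Finset.mem_singleton, funext_iff]
      simp
    simp [this]
  | succ n ih =>
    rw [sum_multiIndices_succ, Fin.sum_univ_succ t]
    have h := sum_antidiagonal_laguerre_mul 0 n k (t 0) (∑ j, t (Fin.succ j))
    rw [zero_add] at h
    rw [← h]
    refine Finset.sum_congr rfl fun p _ => ?_
    rw [← ih p.2 fun j => t j.succ, Finset.mul_sum]
    refine Finset.sum_congr rfl fun β _ => ?_
    rw [Fin.prod_univ_succ, Fin.cons_zero]
    simp_rw [Fin.cons_succ]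

theorem sum_range_choose_eq (m j : ℕ) :
    ∑ k ∈ Finset.range (m + 1), (k.choose j : ℝ) = (m + 1).choose (j + 1) := by
  induction m with
  | zero =>
    rcases j with _ | j
    · simp
    · simp [Nat.choose_eq_zero_of_lt (show 0 + 1 < j + 1 + 1 by omega)]
  | succ m ih =>
    rw [Finset.sum_range_succ, ih, Nat.choose_succ_succ (m + 1) j]
    push_cast
    ring

theorem laguerre_zero_eq_sum_range {k N : ℕ} (h : k ≤ N) (t : ℝ) : laguerre 0 k t =
    ∑ j ∈ Finset.range (N + 1), (k.choose j : ℝ) * ((-1) ^ j * t ^ j / j.factorial) := by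
  rw [laguerre]
  refine Finset.sum_subset_zero_on_sdiff (Finset.range_mono (by omega)) (fun j hj => ?_)
    fun j hj => ?_
  · simp only [Finset.mem_sdiff, Finset.mem_range, not_lt] at hj
    rw [Nat.choose_eq_zero_of_lt (by omega)]
    simp
  · rw [add_zero, Nat.choose_symm (by simpa [Nat.lt_succ_iff] using hj)]
    ring

theorem hasDerivAt_laguerre_zero (m : ℕ) (t : ℝ) :
    HasDerivAt (laguerre 0 m) (-∑ k ∈ Finset.range m, laguerre 0 k t) t := by
  have hL : laguerre 0 m = fun t => ∑ j ∈ Finset.range (m + 1),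
      (m.choose j : ℝ) * ((-1) ^ j * t ^ j / j.factorial) :=
    funext (laguerre_zero_eq_sum_range le_rfl)
  rw [hL]
  have hd := HasDerivAt.fun_sum (u := Finset.range (m + 1)) fun j _ =>
    ((((hasDerivAt_pow j t).const_mul ((-1) ^ j)).div_const (j.factorial : ℝ)).const_mul
      (m.choose j : ℝ))
  refine hd.congr_deriv ?_
  rw [Finset.sum_range_succ']
  rcases m with _ | m
  · simp
  have hs : ∑ k ∈ Finset.range (m + 1), laguerre 0 k t = ∑ k ∈ Finset.range (m + 1),
      ∑ j ∈ Finset.range (m + 1), (k.choose j : ℝ) * ((-1) ^ j * t ^ j / j.factorial) :=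
    Finset.sum_congr rfl fun k hk => laguerre_zero_eq_sum_range
      (Nat.lt_succ_iff.1 (Finset.mem_range.1 hk)) t
  rw [hs, Finset.sum_comm]
  simp_rw [← Finset.sum_mul, sum_range_choose_eq]
  rw [← Finset.sum_neg_distrib]
  simp only [Nat.cast_zero, zero_mul, mul_zero, zero_div, add_zero]
  refine Finset.sum_congr rfl fun j _ => ?_
  rw [Nat.factorial_succ, Nat.add_sub_cancel]
  push_cast
  field_simp
  ring

theorem laguerre_apply_zero (m : ℕ) : laguerre 0 m 0 = 1 := by
  rw [laguerre_zero_eq_sum_range le_rfl, Finset.sum_range_succ']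
  simp

theorem im_conj_aeval_physHermite_mul_succ (m : ℕ) (w : ℂ) :
    (starRingEnd ℂ (Polynomial.aeval w (physHermite m)) *
      Polynomial.aeval w (physHermite (m + 1))).im =
    2 ^ m * m.factorial * (2 * w.im * ∑ k ∈ Finset.range (m + 1),
      ‖Polynomial.aeval w (physHermite k)‖ ^ 2 / (2 ^ k * k.factorial)) := by
  induction m with
  | zero => simp [physHermite]
  | succ m ih =>
    have hrec : Polynomial.aeval w (physHermite (m + 2)) =
        2 * w * Polynomial.aeval w (physHermite (m + 1)) -
          ((2 * (m + 1 : ℝ) : ℝ) : ℂ) * Polynomial.aeval w (physHermite m) := by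
      rw [physHermite_add_two]
      simp
    rw [Finset.sum_range_succ, mul_add, mul_add, hrec, Nat.factorial_succ]
    generalize ∑ k ∈ Finset.range (m + 1),
      ‖Polynomial.aeval w (physHermite k)‖ ^ 2 / (2 ^ k * k.factorial) = S at *
    generalize Polynomial.aeval w (physHermite m) = a at *
    generalize Polynomial.aeval w (physHermite (m + 1)) = b at *
    rw [Complex.sq_norm, Complex.normSq_apply]
    simp only [Complex.mul_im, Complex.mul_re, Complex.sub_im, Complex.sub_re, Complex.conj_re,
      Complex.conj_im, Complex.ofReal_re, Complex.ofReal_im, Complex.re_ofNat,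
      Complex.im_ofNat] at ih ⊢
    push_cast
    have h2 : (2 : ℝ) ^ (m + 1) * ((m + 1) * m.factorial) ≠ 0 := by positivity
    field_simp
    linear_combination 2 * (m + 1 : ℝ) * ih

theorem hasDerivAt_norm_sq_aeval_physHermite_succ (m : ℕ) (x y : ℝ) :
    HasDerivAt (fun y : ℝ =>
      ‖Polynomial.aeval ((x : ℂ) + Complex.I * y) (physHermite (m + 1))‖ ^ 2 /
        (2 ^ (m + 1) * (m + 1).factorial))
      (4 * y * ∑ k ∈ Finset.range (m + 1),
        ‖Polynomial.aeval ((x : ℂ) + Complex.I * y) (physHermite k)‖ ^ 2 /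
          (2 ^ k * k.factorial)) y := by
  have hw : HasDerivAt (fun y : ℝ => (x : ℂ) + Complex.I * y) Complex.I y := by
    simpa using (Complex.ofRealCLM.hasDerivAt.const_mul Complex.I).const_add (x : ℂ)
  have hp := ((physHermite (m + 1)).hasDerivAt_aeval ((x : ℂ) + Complex.I * y)).comp y hw
  refine (hp.norm_sq.div_const _).congr_deriv ?_
  have h := im_conj_aeval_physHermite_mul_succ m ((x : ℂ) + Complex.I * y)
  simp only [Function.comp_apply, Complex.inner]
  rw [derivative_physHermite_succ, map_mul, Polynomial.aeval_C, Nat.factorial_succ,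
    Complex.coe_algebraMap]
  generalize ∑ k ∈ Finset.range (m + 1),
    ‖Polynomial.aeval ((x : ℂ) + Complex.I * y) (physHermite k)‖ ^ 2 /
      (2 ^ k * k.factorial) = S at *
  generalize Polynomial.aeval ((x : ℂ) + Complex.I * y) (physHermite m) = a at *
  generalize Polynomial.aeval ((x : ℂ) + Complex.I * y) (physHermite (m + 1)) = b at *
  simp only [Complex.mul_im, Complex.mul_re, Complex.add_im, Complex.conj_re,
      Complex.conj_im, Complex.ofReal_re, Complex.ofReal_im, Complex.I_re, Complex.I_im] at h ⊢
  push_cast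
  field_simp
  linear_combination 4 * (m + 1 : ℝ) * h

theorem hasDerivAt_laguerre_zero_neg_two_mul_sq (m : ℕ) (y : ℝ) :
    HasDerivAt (fun y => laguerre 0 m (-2 * y ^ 2))
      (4 * y * ∑ k ∈ Finset.range m, laguerre 0 k (-2 * y ^ 2)) y := by
  refine ((hasDerivAt_laguerre_zero m _).comp y ((hasDerivAt_pow 2 y).const_mul (-2))).congr_deriv ?_
  norm_num
  ring

theorem norm_sq_aeval_physHermite_mul_exp_le (m : ℕ) (x y : ℝ) :
    ‖Polynomial.aeval ((x : ℂ) + Complex.I * y) (physHermite m)‖ ^ 2 / (2 ^ m * m.factorial) *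
      Real.exp (-x ^ 2) ≤ laguerre 0 m (-2 * y ^ 2) := by
  wlog hy : 0 ≤ y generalizing y
  · have h := this (-y) (by linarith)
    rw [neg_sq] at h
    convert h using 4
    rw [← RCLike.norm_conj, ← Polynomial.aeval_conj]
    simp
  induction m using Nat.strong_induction_on generalizing y with
  | _ m ih =>
  rcases m with _ | m
  · simp [physHermite, laguerre, sq_nonneg]
  have hd := fun y => (hasDerivAt_laguerre_zero_neg_two_mul_sq (m + 1) y).fun_sub
    ((hasDerivAt_norm_sq_aeval_physHermite_succ m x y).mul_const (Real.exp (-x ^ 2)))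
  have hmono := monotoneOn_of_deriv_nonneg (convex_Ici (0 : ℝ))
    (fun y _ => (hd y).continuousAt.continuousWithinAt)
    (fun y _ => (hd y).differentiableAt.differentiableWithinAt) fun y hy => by
      rw [interior_Ici, Set.mem_Ioi] at hy
      rw [(hd y).deriv, mul_assoc (4 * y), ← mul_sub, Finset.sum_mul, ← Finset.sum_sub_distrib]
      refine mul_nonneg (by positivity) (Finset.sum_nonneg fun k hk => sub_nonneg.2 ?_)
      exact ih k (Finset.mem_range.1 hk) y hy.le
  have h := hmono Set.self_mem_Ici (Set.mem_Ici.2 hy) hy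
  have h0 := physHermite_sq_mul_exp_le (m + 1) x
  refine sub_nonneg.1 (le_trans (sub_nonneg.2 ?_) h)
  have hx : Polynomial.aeval ((x : ℂ) + Complex.I * (0 : ℝ)) (physHermite (m + 1)) =
      (((physHermite (m + 1)).eval x : ℝ) : ℂ) := by
    rw [Complex.ofReal_zero, mul_zero, add_zero]
    exact Polynomial.aeval_algebraMap_apply_eq_algebraMap_eval x _
  rw [hx, Complex.norm_real, Real.norm_eq_abs, sq_abs, div_mul_eq_mul_div,
    div_le_iff₀ (by positivity)]
  simpa [laguerre_apply_zero] using h0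

theorem iteratedDeriv_cexp_neg_sq (m : ℕ) : iteratedDeriv m (fun s : ℂ => Complex.exp (-s ^ 2)) =
    fun w => (-1) ^ m * Polynomial.aeval w (physHermite m) * Complex.exp (-w ^ 2) := by
  induction m with
  | zero => simp [physHermite]
  | succ m ih =>
    rw [iteratedDeriv_succ, ih]
    funext w
    have h1 := ((physHermite m).hasDerivAt_aeval w).const_mul ((-1 : ℂ) ^ m)
    have h2 := (hasDerivAt_pow 2 w).fun_neg.cexp
    rw [(h1.fun_mul h2).deriv, physHermite_succ]
    simp
    ring

theorem hermitePolyC_eq_aeval (m : ℕ) (w : ℂ) :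
    hermitePolyC m w = Polynomial.aeval w (physHermite m) := by
  simp only [hermitePolyC, iteratedDeriv_cexp_neg_sq]
  rw [Complex.exp_neg]
  have := Complex.exp_ne_zero (w ^ 2)
  have hm : (-1 : ℂ) ^ m * (-1) ^ m = 1 := by rw [← mul_pow]; simp
  field_simp
  linear_combination Polynomial.aeval w (physHermite m) * hm

theorem norm_sq_hermiteFnC_le (m : ℕ) (x y : ℝ) :
    ‖hermiteFnC m ((x : ℂ) + Complex.I * y)‖ ^ 2 ≤
      (√π)⁻¹ * (laguerre 0 m (-2 * y ^ 2) * Real.exp (y ^ 2)) := by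
  have h := norm_sq_aeval_physHermite_mul_exp_le m x y
  have hpi : 0 < √π := Real.sqrt_pos.2 Real.pi_pos
  rw [hermiteFnC, hermitePolyC_eq_aeval, norm_mul, norm_mul, mul_pow, mul_pow, norm_inv,
    Complex.norm_real, Real.norm_eq_abs, inv_pow, sq_abs, Real.sq_sqrt (by positivity),
    Complex.norm_exp, ← Real.exp_nat_mul]
  have he : ((2 : ℕ) : ℝ) * (-((x : ℂ) + Complex.I * y) ^ 2 / 2).re = -x ^ 2 + y ^ 2 := by
    simp [sq]
    ring
  rw [he, Real.exp_add]
  refine le_trans (le_of_eq ?_) (mul_le_mul_of_nonneg_left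
    (mul_le_mul_of_nonneg_right h (Real.exp_pos (y ^ 2)).le) (inv_pos.2 hpi).le)
  field_simp

/-- The pointwise bound `Σ_{|α|=k} |Φ_α(x+iy)|² ≤ π^{−n/2} L_k^{n−1}(−2|y|²) e^{|y|²}`
for the entire extensions of the Hermite functions. -/
theorem hermite_sum_sq_bound {n : ℕ} (hn : 1 ≤ n) (k : ℕ)
    (x y : EuclideanSpace ℝ (Fin n)) :
    ∑ α ∈ multiIndices n k,
        ‖hermiteFnPiC α (fun j => (x j : ℂ) + Complex.I * (y j : ℂ))‖ ^ 2
      ≤ Real.pi ^ (-(n : ℝ) / 2) * (laguerre (n - 1) k (-2 * ‖y‖ ^ 2) * Real.exp (‖y‖ ^ 2)) := by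
  obtain ⟨n, rfl⟩ := Nat.exists_eq_add_of_le' hn
  have hpi : Real.pi ^ (-((n + 1 : ℕ) : ℝ) / 2) = (√π)⁻¹ ^ (n + 1) := by
    rw [Real.sqrt_eq_rpow, ← Real.rpow_neg Real.pi_pos.le, ← Real.rpow_mul_natCast Real.pi_pos.le]
    congr 1
    ring
  rw [Nat.add_sub_cancel, EuclideanSpace.real_norm_sq_eq, Finset.mul_sum,
    ← sum_multiIndices_prod_laguerre, Real.exp_sum, hpi, Finset.sum_mul, Finset.mul_sum]
  refine Finset.sum_le_sum fun α _ => ?_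
  rw [hermiteFnPiC, norm_prod, ← Finset.prod_pow, ← Finset.prod_mul_distrib]
  refine (Finset.prod_le_prod (fun _ _ => sq_nonneg _) fun j _ =>
    norm_sq_hermiteFnC_le (α j) (x j) (y j)).trans_eq ?_
  rw [Finset.prod_mul_distrib, Finset.prod_const, Finset.card_univ, Fintype.card_fin]
end

section
/- Let n ≥ 0 be an integer and s > 1 a real number with conjugate exponent s' = s/(s−1). Then there exists a constant c > 0 such that for every A > 0: ∫_0^∞ t^n e^{−t^s/s + A t} dt ≥ c · A^{(n+1)s'/s} · e^{A^{s'}/(2s')}. -/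
open MeasureTheory Real

/-- The integrand `tⁿ e^{−t^s/s + At}` is integrable on the positive half-line. -/
theorem integrableOn_pow_mul_exp_neg_rpow_add_mul (n : ℕ) {s A : ℝ} (hs : 1 < s) (hA : 0 < A) :
    IntegrableOn (fun t : ℝ => t ^ n * Real.exp (-(t ^ s) / s + A * t)) (Set.Ioi 0) := by
  have hs0 : 0 < s := by linarith
  set M : ℝ := (2 * s * A) ^ (1 / (s - 1)) with hM
  have hMpos : 0 < M := by positivity
  have hMpow : M ^ (s - 1) = 2 * s * A := by
    rw [hM, ← Real.rpow_mul (by positivity), one_div_mul_cancel (by linarith), Real.rpow_one]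
  have hdom := (integrableOn_rpow_mul_exp_neg_mul_rpow (p := s) (s := n) (b := 1 / (2 * s))
    (by linarith [Nat.cast_nonneg (α := ℝ) n]) hs0 (by positivity)).const_mul (Real.exp (A * M))
  refine Integrable.mono' hdom (ContinuousOn.aestronglyMeasurable ?_ measurableSet_Ioi) ?_
  · refine (continuous_pow n).continuousOn.mul (Continuous.continuousOn ?_)
    have := Real.continuous_rpow_const hs0.le
    fun_prop
  · filter_upwards [ae_restrict_mem measurableSet_Ioi] with t ht
    have ht : 0 < t := ht
    have hts : 0 < t ^ s := Real.rpow_pos_of_pos ht s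
    have hbound : A * t ≤ A * M + t ^ s / (2 * s) := by
      rcases le_total t M with h | h
      · have : A * t ≤ A * M := by gcongr
        have : 0 ≤ t ^ s / (2 * s) := by positivity
        linarith
      · have hsplit : t ^ s = t ^ (s - 1) * t := by
          rw [← Real.rpow_add_one ht.ne', sub_add_cancel]
        have h1 : 2 * s * A ≤ t ^ (s - 1) := hMpow ▸
          Real.rpow_le_rpow hMpos.le h (by linarith)
        have h2 : A * t ≤ t ^ s / (2 * s) := by
          rw [le_div_iff₀ (by positivity), hsplit]
          nlinarith
        have : 0 < A * M := by positivity
        linarith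
    rw [Real.norm_of_nonneg (by positivity), Real.rpow_natCast, mul_left_comm, ← Real.exp_add]
    refine mul_le_mul_of_nonneg_left (Real.exp_le_exp.2 ?_) (by positivity)
    have : -(t ^ s) / s = -(t ^ s / (2 * s)) - t ^ s / (2 * s) := by field_simp; ring
    have : -(1 / (2 * s)) * t ^ s = -(t ^ s / (2 * s)) := by ring
    linarith

/-- A lower bound for the Laplace-type integral `∫_0^∞ tⁿ e^{−t^s/s + At} dt`:
it is at least `c · A^{(n+1)s'/s} e^{A^{s'}/(2s')}` where `s' = s/(s−1)`. -/
theorem laplace_integral_lower_bound (n : ℕ) (s : ℝ) (hs : 1 < s) :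
    ∃ c : ℝ, 0 < c ∧ ∀ A : ℝ, 0 < A →
      (∫ t in Set.Ioi (0 : ℝ), t ^ n * Real.exp (-(t ^ s) / s + A * t))
        ≥ c * A ^ (((n : ℝ) + 1) * (s / (s - 1)) / s) *
            Real.exp (A ^ (s / (s - 1)) / (2 * (s / (s - 1)))) := by
  refine ⟨(1 / 2) ^ (n + 1), by positivity, fun A hA => ?_⟩
  have hs0 : 0 < s := by linarith
  have hs1 : 0 < s - 1 := by linarith
  set T : ℝ := A ^ (1 / (s - 1)) with hT
  have hTpos : 0 < T := Real.rpow_pos_of_pos hA _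
  have hTA : T ^ (s - 1) = A := by
    rw [hT, ← Real.rpow_mul hA.le, one_div_mul_cancel hs1.ne', Real.rpow_one]
  have hpow : A ^ (((n : ℝ) + 1) * (s / (s - 1)) / s) = T ^ (n + 1) := by
    rw [hT, ← Real.rpow_natCast, ← Real.rpow_mul hA.le]
    congr 1
    push_cast
    field_simp
  have hexp : A ^ (s / (s - 1)) = A * T := by
    rw [hT, mul_comm, ← Real.rpow_add_one hA.ne']
    congr 1
    field_simp
    ring
  rw [hpow, hexp]
  have hint := integrableOn_pow_mul_exp_neg_rpow_add_mul n hs hA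
  have hsub : Set.Ioc (T / 2) T ⊆ Set.Ioi 0 := fun t ht => (half_pos hTpos).trans ht.1
  have hlower : ∀ t ∈ Set.Ioc (T / 2) T,
      (T / 2) ^ n * Real.exp (A * T / (2 * (s / (s - 1)))) ≤
        t ^ n * Real.exp (-(t ^ s) / s + A * t) := by
    intro t ht
    have ht0 : 0 < t := hsub ht
    have hts : t ^ s ≤ A * t := by
      have hsplit : t ^ s = t ^ (s - 1) * t := by
        rw [← Real.rpow_add_one ht0.ne', sub_add_cancel]
      rw [hsplit, ← hTA]
      gcongr
      exact ht.2
    gcongr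
    · exact ht.1.le
    · have h1 : A * T / (2 * (s / (s - 1))) = A * (T / 2) * (s - 1) / s := by field_simp
      have h2 : -(t ^ s) / s + A * t = (s * (A * t) - t ^ s) / s := by field_simp; ring
      rw [h1, h2]
      gcongr
      have h3 : A * (T / 2) * (s - 1) ≤ A * t * (s - 1) := by
        gcongr
        exact ht.1.le
      linarith
  calc (1 / 2) ^ (n + 1) * T ^ (n + 1) * Real.exp (A * T / (2 * (s / (s - 1))))
      = (T / 2) ^ n * Real.exp (A * T / (2 * (s / (s - 1)))) *
          volume.real (Set.Ioc (T / 2) T) := by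
        rw [Real.volume_real_Ioc_of_le (by linarith), div_pow, div_pow]
        field_simp
        ring
    _ ≤ ∫ t in Set.Ioc (T / 2) T, t ^ n * Real.exp (-(t ^ s) / s + A * t) :=
        setIntegral_ge_of_const_le_real measurableSet_Ioc measure_Ioc_lt_top.ne hlower
          (hint.mono_set hsub)
    _ ≤ ∫ t in Set.Ioi (0 : ℝ), t ^ n * Real.exp (-(t ^ s) / s + A * t) := by
        refine setIntegral_mono_set hint ?_ hsub.eventuallyLE
        filter_upwards [ae_restrict_mem measurableSet_Ioi] with t ht
        have ht : 0 < t := ht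
        show 0 ≤ t ^ n * Real.exp (-(t ^ s) / s + A * t)
        positivity
end

section
/- (Hedenmalm's strip lemma.) Let n ≥ 1 be an integer and let F : ℂ → ℂ be continuous and bounded on the closed strip {ζ ∈ ℂ : |Im ζ| ≤ 1}, holomorphic on the open strip {|Im ζ| < 1}, and satisfy F(r) = |r|^{−n} · conj(F(1/r)) for every real r ≠ 0. Then F(ζ) = 0 for every ζ in the closed strip. -/
open Complex

/-- The reflection of `f` in the unit circle, weighted by `z ^ (-m)`. -/
noncomputable def circleReflection (m : ℕ) (f : ℂ → ℂ) (z : ℂ) : ℂ :=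
  (z ^ m)⁻¹ * (starRingEnd ℂ) (f ((starRingEnd ℂ) z⁻¹))

theorem isOpen_abs_im_lt_one : IsOpen {z : ℂ | |z.im| < 1} :=
  isOpen_lt (by fun_prop) continuous_const

theorem isOpen_abs_im_lt_normSq : IsOpen {z : ℂ | |z.im| < normSq z} :=
  isOpen_lt (by fun_prop) continuous_normSq

theorem abs_im_conj_inv (z : ℂ) : |((starRingEnd ℂ) z⁻¹).im| = |z.im| / normSq z := by
  rw [conj_im, abs_neg, inv_im, abs_div, abs_neg, abs_of_nonneg (normSq_nonneg z)]

theorem normSq_pos_of_abs_im_lt {z : ℂ} (hz : |z.im| < normSq z) : 0 < normSq z :=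
  (abs_nonneg _).trans_lt hz

theorem differentiableOn_circleReflection (m : ℕ) {f : ℂ → ℂ}
    (hf : DifferentiableOn ℂ f {z : ℂ | |z.im| < 1}) :
    DifferentiableOn ℂ (circleReflection m f) {z : ℂ | |z.im| < normSq z} := by
  intro z hz
  have hpos := normSq_pos_of_abs_im_lt hz
  have hz0 : z ≠ 0 := normSq_pos.1 hpos
  have hmem : |((starRingEnd ℂ) z⁻¹).im| < 1 := by
    rw [abs_im_conj_inv, div_lt_one hpos]
    exact hz
  have hfd : DifferentiableAt ℂ f ((starRingEnd ℂ) z⁻¹) :=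
    hf.differentiableAt (isOpen_abs_im_lt_one.mem_nhds hmem)
  have hc : DifferentiableAt ℂ ((starRingEnd ℂ) ∘ f ∘ (starRingEnd ℂ)) z⁻¹ := by
    simpa using hfd.conj_conj
  have hcomp := hc.comp z (differentiableAt_inv hz0)
  exact (((differentiableAt_id.pow m).inv (pow_ne_zero m hz0)).mul hcomp).differentiableWithinAt

theorem norm_circleReflection_le (m : ℕ) {f : ℂ → ℂ} {C : ℝ}
    (hC : ∀ z : ℂ, |z.im| ≤ 1 → ‖f z‖ ≤ C) {z : ℂ} (hz : |z.im| ≤ normSq z) :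
    ‖circleReflection m f z‖ ≤ (‖z‖ ^ m)⁻¹ * C := by
  have hmem : |((starRingEnd ℂ) z⁻¹).im| ≤ 1 := by
    rw [abs_im_conj_inv]
    exact div_le_one_of_le₀ hz (normSq_nonneg z)
  rw [circleReflection, norm_mul, norm_inv, norm_pow, RCLike.norm_conj]
  gcongr
  exact hC _ hmem

/-- The right half of the strip with the discs of diameter `[0, ±i]` removed. -/
theorem isPreconnected_right_strip_diff_discs :
    IsPreconnected {z : ℂ | |z.im| < 1 ∧ |z.im| < normSq z ∧ 0 < z.re} := by
  have hconv : Convex ℝ (re ⁻¹' Set.Ici 1 ∩ im ⁻¹' Set.Ioo (-1) 1) :=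
    ((convex_Ici (1 : ℝ)).linear_preimage reLm).inter
      ((convex_Ioo (-1 : ℝ) 1).linear_preimage imLm)
  apply isPreconnected_of_forall (2 : ℂ)
  intro z ⟨hz1, hz2, hz3⟩
  have hline : Convex ℝ (re ⁻¹' Set.Ici z.re ∩ im ⁻¹' {z.im}) :=
    ((convex_Ici z.re).linear_preimage reLm).inter
      ((convex_singleton z.im).linear_preimage imLm)
  refine ⟨(re ⁻¹' Set.Ici 1 ∩ im ⁻¹' Set.Ioo (-1) 1) ∪ (re ⁻¹' Set.Ici z.re ∩ im ⁻¹' {z.im}),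
    ?_, Or.inl (by simp), Or.inr (by simp), ?_⟩
  · rintro w (⟨h1, h2⟩ | ⟨h1, h2⟩)
    · simp only [Set.mem_preimage, Set.mem_Ici] at h1
      have h2' : |w.im| < 1 := abs_lt.2 h2
      refine ⟨h2', ?_, by linarith⟩
      rw [normSq_apply]
      nlinarith [mul_self_nonneg w.im]
    · simp only [Set.mem_preimage, Set.mem_Ici, Set.mem_singleton_iff] at h1 h2
      refine ⟨by rwa [h2], ?_, by linarith⟩
      rw [normSq_apply] at hz2 ⊢
      rw [h2]
      nlinarith
  · refine IsPreconnected.union (⟨max 1 z.re, z.im⟩ : ℂ) ?_ ?_ hconv.isPreconnected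
      hline.isPreconnected
    · exact ⟨le_max_left 1 z.re, abs_lt.1 hz1⟩
    · exact ⟨le_max_right 1 z.re, rfl⟩

theorem eq_circleReflection_of_re_pos (m : ℕ) {f : ℂ → ℂ}
    (hf : DifferentiableOn ℂ f {z : ℂ | |z.im| < 1})
    (hfe : ∀ r : ℝ, 0 < r → f r = circleReflection m f r)
    {z : ℂ} (hz1 : |z.im| < 1) (hz2 : |z.im| < normSq z) (hz3 : 0 < z.re) :
    f z = circleReflection m f z := by
  have hopen : IsOpen {z : ℂ | |z.im| < 1 ∧ |z.im| < normSq z ∧ 0 < z.re} :=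
    isOpen_abs_im_lt_one.inter
      (isOpen_abs_im_lt_normSq.inter (isOpen_lt continuous_const continuous_re))
  have hfan := (hf.mono fun w hw => hw.1 :
    DifferentiableOn ℂ f {z : ℂ | |z.im| < 1 ∧ |z.im| < normSq z ∧ 0 < z.re}).analyticOnNhd hopen
  have hgan := ((differentiableOn_circleReflection m hf).mono fun w hw => hw.2.1 :
    DifferentiableOn ℂ (circleReflection m f)
      {z : ℂ | |z.im| < 1 ∧ |z.im| < normSq z ∧ 0 < z.re}).analyticOnNhd hopen
  refine hfan.eqOn_of_preconnected_of_frequently_eq hgan isPreconnected_right_strip_diff_discs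
    (z₀ := ((1 : ℝ) : ℂ)) (by simp) ?_ ⟨hz1, hz2, hz3⟩
  have htend : Filter.Tendsto (fun r : ℝ => (r : ℂ)) (nhdsWithin 1 {1}ᶜ)
      (nhdsWithin ((1 : ℝ) : ℂ) {((1 : ℝ) : ℂ)}ᶜ) :=
    continuous_ofReal.continuousWithinAt.tendsto_nhdsWithin fun r hr => by
      simpa using hr
  refine htend.frequently (Filter.Eventually.frequently ?_)
  filter_upwards [mem_nhdsWithin_of_mem_nhds (lt_mem_nhds (zero_lt_one' ℝ))] with r hr
  exact hfe r hr

theorem eq_circleReflection {m : ℕ} (hm : Even m) {f : ℂ → ℂ}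
    (hf : DifferentiableOn ℂ f {z : ℂ | |z.im| < 1})
    (hfe : ∀ r : ℝ, r ≠ 0 → f r = circleReflection m f r)
    {z : ℂ} (hz1 : |z.im| < 1) (hz2 : |z.im| < normSq z) :
    f z = circleReflection m f z := by
  have hneg : ∀ w, circleReflection m (fun z => f (-z)) w = circleReflection m f (-w) := by
    intro w
    simp [circleReflection, hm.neg_pow, inv_neg]
  rcases lt_trichotomy z.re 0 with h | h | h
  · have hf' : DifferentiableOn ℂ (fun z => f (-z)) {z : ℂ | |z.im| < 1} :=
      hf.comp differentiable_neg.differentiableOn fun w hw => by simpa using hw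
    have := eq_circleReflection_of_re_pos m (f := fun z => f (-z)) hf'
      (fun r hr => by
        rw [hneg]
        simpa using hfe (-r) (by linarith : -r < 0).ne)
      (z := -z) (by simpa using hz1) (by simpa using hz2) (by simpa using h)
    rw [hneg] at this
    simpa using this
  · rw [normSq_apply, h] at hz2
    nlinarith [abs_mul_abs_self z.im, abs_nonneg z.im]
  · exact eq_circleReflection_of_re_pos m hf (fun r hr => hfe r hr.ne') hz1 hz2 h

theorem abs_im_lt_normSq_of_one_le {z : ℂ} (hz : 1 ≤ |z.im|) (hne : z ^ 2 + 1 ≠ 0) :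
    |z.im| < normSq z := by
  rw [normSq_apply, ← abs_mul_abs_self z.im]
  by_contra! hle
  have him : |z.im| = 1 := by nlinarith [mul_self_nonneg z.re]
  have hre : z.re = 0 := by
    rw [him] at hle
    exact mul_self_eq_zero.1 (le_antisymm (by linarith) (mul_self_nonneg _))
  apply hne
  have hsq : z.im * z.im = 1 := by rw [← abs_mul_abs_self, him, one_mul]
  apply Complex.ext <;> simp [sq, hre, hsq]

/-- A function that is complex differentiable off the zeros of `p` and bounded yields an entire
function after multiplication by `p`. -/
theorem differentiable_mul_of_bounded {p H : ℂ → ℂ} (hp : Differentiable ℂ p)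
    (hfin : {z | p z = 0}.Finite) {C : ℝ} (hC : ∀ z, ‖H z‖ ≤ C)
    (hH : ∀ z, p z ≠ 0 → DifferentiableAt ℂ H z) : Differentiable ℂ (fun z => p z * H z) := by
  intro z
  by_cases hz : p z = 0
  · refine (analyticAt_of_differentiable_on_punctured_nhds_of_continuousAt ?_ ?_).differentiableAt
    · have : ({z | p z = 0} \ {z})ᶜ ∈ nhds z :=
        (hfin.subset Set.sdiff_subset).isClosed.isOpen_compl.mem_nhds (by simp)
      filter_upwards [mem_nhdsWithin_of_mem_nhds this, self_mem_nhdsWithin] with w hw hne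
      exact (hp w).mul (hH w fun h => hw ⟨h, hne⟩)
    · have h0 : Filter.Tendsto (fun w => ‖p w‖ * C) (nhds z) (nhds 0) := by
        have := ((hp z).continuousAt.norm.mul_const C)
        simpa [ContinuousAt, hz] using this
      rw [ContinuousAt, hz, zero_mul]
      refine squeeze_zero_norm (fun w => ?_) h0
      rw [norm_mul]
      gcongr
      exact hC w
  · exact (hp z).mul (hH z hz)

/-- The strip lemma for an even weight. -/
theorem eq_zero_of_eq_circleReflection {m : ℕ} (hm : Even m) (hm2 : 2 ≤ m) {f : ℂ → ℂ}
    (hf : DifferentiableOn ℂ f {z : ℂ | |z.im| < 1})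
    {C : ℝ} (hC : ∀ z : ℂ, |z.im| ≤ 1 → ‖f z‖ ≤ C)
    (hfe : ∀ r : ℝ, r ≠ 0 → f r = circleReflection m f r)
    {z : ℂ} (hz : |z.im| < 1) : f z = 0 := by
  have hC0 : 0 ≤ C := (norm_nonneg _).trans (hC 0 (by simp))
  set H : ℂ → ℂ := fun z => if |z.im| < 1 then f z else circleReflection m f z
  have hHf : ∀ z : ℂ, |z.im| < 1 → H z = f z := fun z hz => if_pos hz
  have hHg : ∀ z : ℂ, |z.im| < normSq z → H z = circleReflection m f z := by
    intro z hz
    by_cases h : |z.im| < 1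
    · rw [hHf z h, eq_circleReflection hm hf hfe h hz]
    · exact if_neg h
  have hdiff : ∀ z : ℂ, z ^ 2 + 1 ≠ 0 → DifferentiableAt ℂ H z := by
    intro z hne
    by_cases h : |z.im| < 1
    · have hs := isOpen_abs_im_lt_one.mem_nhds h
      exact (hf.differentiableAt hs).congr_of_eventuallyEq (Filter.eventually_of_mem hs hHf)
    · have hs := isOpen_abs_im_lt_normSq.mem_nhds (abs_im_lt_normSq_of_one_le (not_lt.1 h) hne)
      exact ((differentiableOn_circleReflection m hf).differentiableAt hs).congr_of_eventuallyEq
        (Filter.eventually_of_mem hs hHg)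
  have hlarge : ∀ z : ℂ, 1 < ‖z‖ → ‖H z‖ ≤ (‖z‖ ^ 2)⁻¹ * C := by
    intro z hz
    have hV : |z.im| < normSq z := by
      rw [normSq_eq_norm_sq]
      nlinarith [abs_im_le_norm z]
    rw [hHg z hV]
    refine (norm_circleReflection_le m hC hV.le).trans ?_
    gcongr
    exact hz.le
  have hbound : ∀ z, ‖H z‖ ≤ C := by
    intro z
    by_cases h : |z.im| < 1
    · rw [hHf z h]
      exact hC z h.le
    · have h1 : 1 ≤ ‖z‖ := (not_lt.1 h).trans (abs_im_le_norm z)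
      have hle : |z.im| ≤ normSq z := by
        rw [normSq_eq_norm_sq]
        nlinarith [abs_im_le_norm z]
      rw [show H z = circleReflection m f z from if_neg h]
      refine (norm_circleReflection_le m hC hle).trans ?_
      exact mul_le_of_le_one_left hC0 (inv_le_one_of_one_le₀ (one_le_pow₀ h1))
  have hroots : ∀ z : ℂ, z ^ 2 + 1 = 0 → z = I ∨ z = -I := by
    intro z hz
    rw [← sq_eq_sq_iff_eq_or_eq_neg, I_sq]
    exact eq_neg_of_add_eq_zero_left hz
  have hfin : {z : ℂ | z ^ 2 + 1 = 0}.Finite :=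
    (Set.toFinite {I, -I}).subset hroots
  have hent : Differentiable ℂ (fun z => (z ^ 2 + 1) * H z) :=
    differentiable_mul_of_bounded (by fun_prop) hfin hbound hdiff
  have hbdd : Bornology.IsBounded (Set.range fun z => (z ^ 2 + 1) * H z) := by
    refine isBounded_iff_forall_norm_le.2 ⟨2 * C, ?_⟩
    rintro _ ⟨w, rfl⟩
    have hp : ‖w ^ 2 + 1‖ ≤ ‖w‖ ^ 2 + 1 := by
      rw [← norm_pow, ← norm_one (α := ℂ)]
      exact norm_add_le (w ^ 2) 1
    simp only [norm_mul]
    rcases le_or_gt ‖w‖ 1 with h | h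
    · have : ‖w ^ 2 + 1‖ ≤ 2 := by nlinarith [norm_nonneg w]
      exact mul_le_mul this (hbound w) (norm_nonneg _) zero_le_two
    · calc ‖w ^ 2 + 1‖ * ‖H w‖ ≤ (2 * ‖w‖ ^ 2) * ((‖w‖ ^ 2)⁻¹ * C) := by
            refine mul_le_mul (by nlinarith) (hlarge w h) (norm_nonneg _) (by positivity)
        _ = 2 * C := by
            have : ‖w‖ ≠ 0 := by linarith
            field_simp
  have hzero := hent.apply_eq_apply_of_bounded hbdd z I
  rw [← hHf z hz]
  simp only [I_sq, neg_add_cancel, zero_mul, mul_eq_zero] at hzero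
  refine hzero.resolve_left fun h => ?_
  rcases hroots z h with rfl | rfl <;> simp at hz

/-- Hedenmalm's strip lemma: a bounded continuous function on the closed strip
`{|Im ζ| ≤ 1}`, holomorphic on the open strip and satisfying the functional
equation `F(r) = |r|^{−n} conj(F(1/r))` for real `r ≠ 0`, vanishes identically
on the closed strip. -/
theorem hedenmalm_strip_lemma (n : ℕ) (hn : 1 ≤ n) (F : ℂ → ℂ)
    (hcont : ContinuousOn F {ζ : ℂ | |ζ.im| ≤ 1})
    (hbdd : ∃ M : ℝ, ∀ ζ : ℂ, |ζ.im| ≤ 1 → ‖F ζ‖ ≤ M)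
    (hhol : DifferentiableOn ℂ F {ζ : ℂ | |ζ.im| < 1})
    (hfe : ∀ r : ℝ, r ≠ 0 →
      F (r : ℂ) = (((|r| ^ n)⁻¹ : ℝ) : ℂ) * (starRingEnd ℂ) (F (((1 / r : ℝ) : ℂ)))) :
    ∀ ζ : ℂ, |ζ.im| ≤ 1 → F ζ = 0 := by
  obtain ⟨M, hM⟩ := hbdd
  have hfe_sq : ∀ r : ℝ, r ≠ 0 →
      (fun z => F z ^ 2) (r : ℂ) = circleReflection (2 * n) (fun z => F z ^ 2) r := by
    intro r hr
    have habs : (((|r| ^ n)⁻¹ : ℝ) : ℂ) ^ 2 = ((r : ℂ) ^ (2 * n))⁻¹ := by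
      rw [← ofReal_pow, inv_pow, ← pow_mul, mul_comm n 2, pow_mul, sq_abs, ← pow_mul]
      push_cast
      rfl
    simp only [circleReflection]
    rw [hfe r hr, mul_pow, habs]
    simp
  have hopen : Set.EqOn F (fun _ => 0) {ζ : ℂ | |ζ.im| < 1} := by
    intro ζ hζ
    refine pow_eq_zero_iff two_ne_zero |>.1 (eq_zero_of_eq_circleReflection (even_two_mul n)
      (by lia) (hhol.pow 2) (C := M ^ 2) (fun z hz => ?_) hfe_sq hζ)
    rw [Pi.pow_apply, norm_pow]
    gcongr
    exact hM z hz
  refine hopen.of_subset_closure hcont continuousOn_const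
    (Set.ofPred_subset_ofPred.2 fun ζ => le_of_lt) ?_
  have hs : {ζ : ℂ | |ζ.im| < 1} = im ⁻¹' Set.Ioo (-1) 1 := by
    ext ζ
    exact abs_lt (a := ζ.im)
  rw [hs, closure_preimage_im, closure_Ioo (by norm_num)]
  exact fun ζ (hζ : |ζ.im| ≤ 1) => abs_le.1 hζ
end

section
/- Let n ≥ 1 be an integer, a > 0 and r ∈ ℝ. Then the series Σ_{k=0}^∞ e^{−a(2k+n)} L_k^{n−1}(−2r²) e^{r²} converges (its terms are nonnegative) and equals (2 sinh a)^{−n} e^{(coth a) r²}. -/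
open Real

/-- The inner sums, over `m`, of the double series behind the Laguerre generating function. -/
lemma hasSum_laguerre_inner (α j : ℕ) (s : ℝ) {q : ℝ} (hq : ‖q‖ < 1) :
    HasSum (fun m : ℕ => s ^ j / (j.factorial : ℝ) *
        ((m + (j + α)).choose (j + α) : ℝ) * q ^ (j + m))
      ((1 / (1 - q) ^ (α + 1)) * ((s * q / (1 - q)) ^ j / (j.factorial : ℝ))) := by
  have h := (hasSum_choose_mul_geometric_of_norm_lt_one (j + α) hq).mul_left
    (s ^ j * q ^ j / (j.factorial : ℝ))
  have hq1 : 1 - q ≠ 0 := by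
    have := (abs_lt.mp hq).2
    linarith
  convert! h using 1
  · ext m
    ring
  · rw [div_pow, mul_pow]
    field_simp
    ring

/-- The sums over `j` of the inner sums: an exponential series. -/
lemma hasSum_laguerre_outer (α : ℕ) (s q : ℝ) :
    HasSum (fun j : ℕ => (1 / (1 - q) ^ (α + 1)) *
        ((s * q / (1 - q)) ^ j / (j.factorial : ℝ)))
      ((1 / (1 - q) ^ (α + 1)) * exp (s * q / (1 - q))) := by
  rw [exp_eq_exp_ℝ]
  exact (NormedSpace.expSeries_div_hasSum_exp (s * q / (1 - q))).mul_left _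

/-- The double series behind the Laguerre generating function. -/
lemma hasSum_laguerre_double (α : ℕ) (s : ℝ) {q : ℝ} (hq : ‖q‖ < 1) :
    HasSum (fun p : ℕ × ℕ => s ^ p.1 / (p.1.factorial : ℝ) *
        ((p.2 + (p.1 + α)).choose (p.1 + α) : ℝ) * q ^ (p.1 + p.2))
      ((1 / (1 - q) ^ (α + 1)) * exp (s * q / (1 - q))) := by
  have hs : Summable (fun p : ℕ × ℕ => s ^ p.1 / (p.1.factorial : ℝ) *
      ((p.2 + (p.1 + α)).choose (p.1 + α) : ℝ) * q ^ (p.1 + p.2)) := by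
    have hq' : ‖‖q‖‖ < 1 := by rwa [norm_norm]
    refine Summable.of_norm ?_
    simp only [norm_mul, norm_div, norm_pow, RCLike.norm_natCast]
    refine (summable_prod_of_nonneg fun p => by positivity).mpr ⟨fun j => ?_, ?_⟩
    · exact (hasSum_laguerre_inner α j ‖s‖ hq').summable
    · simp only [(hasSum_laguerre_inner α _ ‖s‖ hq').tsum_eq]
      exact (hasSum_laguerre_outer α ‖s‖ ‖q‖).summable
  have h := hs.hasSum.prod_fiberwise fun j => hasSum_laguerre_inner α j s hq
  rw [← h.unique (hasSum_laguerre_outer α s q)]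
  exact hs.hasSum

/-- The generating function of the Laguerre polynomials. -/
theorem hasSum_laguerre_mul_pow (α : ℕ) (t : ℝ) {q : ℝ} (hq : ‖q‖ < 1) :
    HasSum (fun k : ℕ => laguerre α k t * q ^ k)
      ((1 / (1 - q) ^ (α + 1)) * exp (-t * q / (1 - q))) := by
  have h := (Finset.HasAntidiagonal.sigmaAntidiagonalEquivProd.hasSum_iff.mpr
    (hasSum_laguerre_double α (-t) hq)).sigma fun k => hasSum_fintype _
  convert! h using 1
  ext k
  simp only [Function.comp_apply, Finset.HasAntidiagonal.sigmaAntidiagonalEquivProd_apply]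
  rw [Finset.sum_coe_sort (Finset.HasAntidiagonal.antidiagonal k) fun p : ℕ × ℕ =>
      (-t) ^ p.1 / (p.1.factorial : ℝ) *
        ((p.2 + (p.1 + α)).choose (p.1 + α) : ℝ) * q ^ (p.1 + p.2),
    Finset.Nat.sum_antidiagonal_eq_sum_range_succ_mk, laguerre, Finset.sum_mul]
  refine Finset.sum_congr rfl fun j hj => ?_
  have hjk : j ≤ k := Nat.lt_succ_iff.mp (Finset.mem_range.mp hj)
  have hc : (k + α).choose (k - j) = (k - j + (j + α)).choose (j + α) := by
    rw [← Nat.choose_symm_add]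
    congr 1
    lia
  rw [hc, Nat.add_sub_cancel' hjk, neg_pow t]
  ring

/-- The Laguerre generating series identity:
`Σ_k e^{−a(2k+n)} L_k^{n−1}(−2r²) e^{r²} = (2 sinh a)^{−n} e^{(coth a) r²}`. -/
theorem laguerre_series_sum (n : ℕ) (hn : 1 ≤ n) (a r : ℝ) (ha : 0 < a) :
    HasSum
      (fun k : ℕ => Real.exp (-a * (2 * k + n)) * laguerre (n - 1) k (-2 * r ^ 2) *
        Real.exp (r ^ 2))
      (((2 * Real.sinh a) ^ n)⁻¹ *
        Real.exp ((Real.cosh a / Real.sinh a) * r ^ 2)) := by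
  set q := exp (-2 * a) with hqdef
  have hq1 : q < 1 := exp_lt_one_iff.mpr (by linarith)
  have hq : ‖q‖ < 1 := by rwa [norm_of_nonneg (exp_pos _).le]
  have hq0 : 1 - q ≠ 0 := by linarith
  have hsinh : 2 * sinh a = exp a * (1 - q) := by
    rw [mul_sub, hqdef, ← exp_add, sinh_eq]
    ring_nf
  have hcosh : 2 * cosh a = exp a * (1 + q) := by
    rw [mul_add, hqdef, ← exp_add, cosh_eq]
    ring_nf
  have hcoth : cosh a / sinh a = (1 + q) / (1 - q) := by
    rw [← mul_div_mul_left _ _ two_ne_zero, hsinh, hcosh, mul_div_mul_left _ _ (exp_ne_zero a)]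
  have h := (hasSum_laguerre_mul_pow (n - 1) (-2 * r ^ 2) hq).mul_left
    (exp (-a * n) * exp (r ^ 2))
  convert! h using 1
  · ext k
    have hk : exp (-a * (2 * k + n)) = exp (-a * n) * q ^ k := by
      rw [hqdef, ← exp_nat_mul, ← exp_add]
      ring_nf
    rw [hk]
    ring
  · have he : exp (cosh a / sinh a * r ^ 2) =
        exp (r ^ 2) * exp (-(-2 * r ^ 2) * q / (1 - q)) := by
      rw [hcoth, ← exp_add]
      congr 1
      field_simp
      ring
    have hn' : exp (-a * n) = (exp a ^ n)⁻¹ := by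
      rw [← exp_nat_mul, ← exp_neg]
      ring_nf
    rw [he, hn', hsinh, Nat.sub_add_cancel hn, mul_pow, mul_inv]
    ring
end

section
/- Let n ≥ 1 and let (a_k)_{k∈ℕ} be a sequence of nonnegative real numbers such that for every r > 0 the series Σ_{k=0}^∞ (k!(n−1)!/(k+n−1)!) · L_k^{n−1}(−2r²) e^{r²} · a_k² converges. Then for every ρ > 0 there exists C > 0 such that a_k ≤ C e^{−ρ√(2k+n)} for all k ∈ ℕ. -/
open Real

/-- The normalised Laguerre coefficient `k! m! / (k+m)! * binom(k+m, k-j)` equals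
`j! * binom(k, j) * m! / (m+j)!`. -/
lemma factorial_mul_choose_div {m k j : ℕ} (hj : j ≤ k) :
    (k.factorial : ℝ) * m.factorial / (k + m).factorial * (k + m).choose (k - j) =
      j.factorial * (k.choose j * (m.factorial / (m + j).factorial)) := by
  obtain ⟨i, rfl⟩ := Nat.exists_eq_add_of_le hj
  have h1 := Nat.add_choose_mul_factorial_mul_factorial (m + j) i
  have h2 := Nat.add_choose_mul_factorial_mul_factorial i j
  rw [show i + j = j + i by ring] at h2
  rw [Nat.add_sub_cancel_left, ← h2, show j + i + m = m + j + i by ring, ← h1]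
  have h3 : ((m + j + i).choose i : ℝ) ≠ 0 := by
    exact_mod_cast (Nat.choose_pos (Nat.le_add_left i (m + j))).ne'
  push_cast
  field_simp

/-- A binomial coefficient over a factorial quotient, bounded below by a power. -/
lemma one_le_choose_mul_pow {m k j : ℕ} (hj : j * j ≤ k) :
    1 ≤ (k.choose j : ℝ) * (m.factorial / (m + j).factorial) * (2 * (m + 1)) ^ j := by
  have h1 : ((k + 1 - j : ℕ) : ℝ) ^ j ≤ j.factorial * k.choose j := by
    have h := Nat.pow_le_choose (α := ℝ) j k
    rw [div_le_iff₀' (by positivity)] at h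
    exact_mod_cast h
  have h2 : ((m + j).factorial : ℝ) ≤ m.factorial * (m + j) ^ j := by
    rw [← Nat.factorial_mul_ascFactorial]
    exact_mod_cast Nat.mul_le_mul_left _ (Nat.ascFactorial_le_pow_add m j)
  have h3 : (j.factorial : ℝ) ≤ j ^ j := by exact_mod_cast Nat.factorial_le_pow j
  have hjk : j ≤ k := (Nat.le_mul_self j).trans hj
  have h4 : (j : ℝ) * (m + j) ≤ ((k + 1 - j : ℕ) : ℝ) * (2 * (m + 1)) := by
    rw [Nat.cast_sub (by omega)]
    push_cast
    have hk : (j : ℝ) * j ≤ k := by exact_mod_cast hj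
    have hmj : (j : ℝ) * (m + j) ≤ j * j * (m + 1) := by
      have : (j : ℝ) ≤ j * j := by exact_mod_cast Nat.le_mul_self j
      nlinarith [(Nat.cast_nonneg m : (0 : ℝ) ≤ m)]
    have hm : (0 : ℝ) ≤ m + 1 := by positivity
    have : (j : ℝ) * j ≤ 2 * (k + 1 - j) := by nlinarith [sq_nonneg ((j : ℝ) - 1)]
    nlinarith [mul_le_mul_of_nonneg_right this hm]
  have h5 : ((j : ℝ) * (m + j)) ^ j ≤ (((k + 1 - j : ℕ) : ℝ) * (2 * (m + 1))) ^ j := by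
    gcongr
  rw [mul_pow, mul_pow] at h5
  have hjf : (0 : ℝ) < j.factorial := by positivity
  have key : (j.factorial : ℝ) * (m + j).factorial ≤
      j.factorial * (k.choose j * m.factorial * (2 * (m + 1)) ^ j) := by
    calc (j.factorial : ℝ) * (m + j).factorial
        ≤ j ^ j * (m.factorial * (m + j) ^ j) := by gcongr
      _ = m.factorial * (j ^ j * (m + j) ^ j) := by ring
      _ ≤ m.factorial * (((k + 1 - j : ℕ) : ℝ) ^ j * (2 * (m + 1)) ^ j) := by gcongr
      _ ≤ m.factorial * ((j.factorial * k.choose j) * (2 * (m + 1)) ^ j) := by gcongr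
      _ = _ := by ring
  rw [show (k.choose j : ℝ) * (m.factorial / (m + j).factorial) * (2 * (m + 1)) ^ j =
    k.choose j * m.factorial * (2 * (m + 1)) ^ j / (m + j).factorial by ring,
    one_le_div (by positivity)]
  exact le_of_mul_le_mul_left key hjf

/-- Every summand of the normalised Laguerre polynomial is a lower bound at nonpositive
arguments. -/
lemma choose_mul_pow_le_laguerre {m k j : ℕ} (hj : j ≤ k) {x : ℝ} (hx : 0 ≤ x) :
    (k.choose j : ℝ) * (m.factorial / (m + j).factorial) * x ^ j ≤
      (k.factorial : ℝ) * m.factorial / (k + m).factorial * laguerre m k (-x) := by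
  have hterm : ∀ i : ℕ, (-1 : ℝ) ^ i * ((k + m).choose (k - i) : ℝ) / i.factorial * (-x) ^ i =
      (k + m).choose (k - i) / i.factorial * x ^ i := fun i => by
    rw [neg_pow x, ← mul_assoc, mul_comm ((-1 : ℝ) ^ i), mul_div_right_comm,
      mul_assoc (_ / _), ← mul_pow]
    norm_num
  have hle : ((k + m).choose (k - j) : ℝ) / j.factorial * x ^ j ≤ laguerre m k (-x) := by
    unfold laguerre
    simp_rw [hterm]
    exact Finset.single_le_sum (f := fun i => ((k + m).choose (k - i) : ℝ) / i.factorial * x ^ i)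
      (fun i _ => by positivity) (Finset.mem_range.2 (by omega))
  refine le_trans (le_of_eq ?_) (mul_le_mul_of_nonneg_left hle (by positivity))
  have h := factorial_mul_choose_div (m := m) hj
  have hjf : (j.factorial : ℝ) ≠ 0 := by positivity
  have e : (k.choose j : ℝ) * (m.factorial / (m + j).factorial) =
      (k.factorial : ℝ) * m.factorial / (k + m).factorial *
        ((k + m).choose (k - j) / j.factorial) := by
    refine ((eq_div_iff hjf).2 ?_).trans (mul_div_assoc _ _ _)
    rw [h, mul_comm]
  rw [e, mul_assoc]

/-- The normalised Laguerre polynomials at `-2 (m+1) b` grow at least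
like `b ^ √k`. -/
lemma pow_sqrt_le_laguerre (m k : ℕ) {b : ℝ} (hb : 0 ≤ b) :
    b ^ k.sqrt ≤ (k.factorial : ℝ) * m.factorial / (k + m).factorial *
      laguerre m k (-(2 * (m + 1) * b)) := by
  refine le_trans ?_ (choose_mul_pow_le_laguerre (Nat.sqrt_le_self k) (by positivity))
  rw [mul_pow _ b, ← mul_assoc]
  exact le_mul_of_one_le_left (by positivity) (one_le_choose_mul_pow (Nat.sqrt_le k))

/-- If `Σ_k (k!(n−1)!/(k+n−1)!) L_k^{n−1}(−2r²) e^{r²} a_k²` converges for every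
`r > 0`, then the `a_k` decay like `e^{−ρ√(2k+n)}` for every `ρ > 0`. -/
theorem laguerre_summable_decay {n : ℕ} (hn : 1 ≤ n) (a : ℕ → ℝ)
    (ha : ∀ k, 0 ≤ a k)
    (hsum : ∀ r : ℝ, 0 < r →
      Summable (fun k : ℕ =>
        ((Nat.factorial k : ℝ) * (Nat.factorial (n - 1) : ℝ) /
            (Nat.factorial (k + n - 1) : ℝ)) *
          (laguerre (n - 1) k (-2 * r ^ 2) * Real.exp (r ^ 2)) * a k ^ 2)) :
    ∀ ρ : ℝ, 0 < ρ → ∃ C : ℝ, 0 < C ∧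
      ∀ k : ℕ, a k ≤ C * Real.exp (-ρ * Real.sqrt (2 * k + n)) := by
  intro ρ hρ
  obtain ⟨m, rfl⟩ : ∃ m, n = m + 1 := ⟨n - 1, by omega⟩
  set r : ℝ := √((m + 1) * exp (4 * ρ)) with hr
  have hr2 : -2 * r ^ 2 = -(2 * (m + 1) * exp (4 * ρ)) := by
    rw [hr, Real.sq_sqrt (by positivity)]
    ring
  have hs := hsum r (Real.sqrt_pos.2 (by positivity))
  simp only [hr2, Nat.add_sub_cancel, ← Nat.add_assoc] at hs
  have hw : ∀ k, exp (4 * ρ * k.sqrt) ≤ (k.factorial : ℝ) * m.factorial / (k + m).factorial *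
      (laguerre m k (-(2 * (m + 1) * exp (4 * ρ))) * exp (r ^ 2)) := fun k => by
    have h := pow_sqrt_le_laguerre m k (exp_pos (4 * ρ)).le
    rw [← Real.exp_nat_mul, mul_comm (k.sqrt : ℝ)] at h
    rw [← mul_assoc]
    exact h.trans (le_mul_of_one_le_right ((exp_pos _).le.trans h)
      (Real.one_le_exp (sq_nonneg r)))
  set S := ∑' k : ℕ, (k.factorial : ℝ) * m.factorial / (k + m).factorial *
      (laguerre m k (-(2 * (m + 1) * exp (4 * ρ))) * exp (r ^ 2)) * a k ^ 2
  have hS : ∀ k, exp (4 * ρ * k.sqrt) * a k ^ 2 ≤ S := fun k =>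
    (mul_le_mul_of_nonneg_right (hw k) (sq_nonneg _)).trans
      (hs.le_tsum k fun i _ => mul_nonneg ((exp_pos _).le.trans (hw i)) (sq_nonneg _))
  have hS0 : 0 ≤ S := le_trans (by positivity) (hS 0)
  refine ⟨√(S + 1) * exp (ρ * (m + 3)), by positivity, fun k => ?_⟩
  have hk : (k : ℝ) ≤ (k.sqrt + 1) * (k.sqrt + 1) := by
    exact_mod_cast (Nat.lt_succ_sqrt k).le
  have hsq : √(2 * k + (m + 1 : ℕ)) ≤ 2 * k.sqrt + (m + 3) := by
    refine Real.sqrt_le_iff.2 ⟨by positivity, ?_⟩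
    push_cast
    nlinarith [(Nat.cast_nonneg m : (0 : ℝ) ≤ m), (Nat.cast_nonneg k.sqrt : (0 : ℝ) ≤ k.sqrt),
      mul_nonneg (Nat.cast_nonneg m : (0 : ℝ) ≤ m) (Nat.cast_nonneg k.sqrt : (0 : ℝ) ≤ k.sqrt)]
  have hak : a k * exp (2 * ρ * k.sqrt) ≤ √(S + 1) := by
    refine Real.le_sqrt_of_sq_le ?_
    rw [mul_pow, ← Real.exp_nat_mul, mul_comm]
    have := hS k
    rw [show ((2 : ℕ) : ℝ) * (2 * ρ * k.sqrt) = 4 * ρ * k.sqrt by push_cast; ring]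
    linarith
  calc a k = a k * exp (2 * ρ * k.sqrt) * exp (-(2 * ρ * k.sqrt)) := by
        rw [mul_assoc, ← Real.exp_add, add_neg_cancel, Real.exp_zero, mul_one]
    _ ≤ √(S + 1) * exp (ρ * (m + 3) + -ρ * √(2 * k + (m + 1 : ℕ))) := by
        gcongr
        nlinarith [mul_le_mul_of_nonneg_left hsq hρ.le]
    _ = _ := by rw [Real.exp_add, mul_assoc]
end
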